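/- There exists a constant C > 0 depending only on P such that for every admissible prime p and all 1-bounded functions f0, f1 : F_p^2 → ℂ, the average 𝔼_{x1,x2,y} f0(x1,x2) f1(x1+P(y),x2) equals 𝔼_{x1,x2} ( f0(x1,x2) · 𝔼_a f1(a,x2) ) up to an error of absolute value at most C · p^{-1/2}. -/

import Mathlib

open scoped BigOperators ComplexOrder
open Polynomial

noncomputable section

namespace RatCorners

/-- Reduction of a rational number modulo `p` (genuine when `p` does not divide the
denominator). -/
def ratRed (p : ℕ) (q : ℚ) : ZMod p := (q.num : ZMod p) * (q.den : ZMod p)⁻¹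

/-- Coefficientwise reduction of a polynomial with rational coefficients modulo `p`. -/
def polyRed (p : ℕ) (f : Polynomial ℚ) : Polynomial (ZMod p) :=
  f.sum fun n a => Polynomial.C (ratRed p a) * Polynomial.X ^ n

/-- `p` divides no denominator of any coefficient of `P` (with numerator and denominator
of `P` in lowest terms). -/
def Admissible (p : ℕ) (P : RatFunc ℚ) : Prop :=
  (∀ n, ¬ p ∣ (P.num.coeff n).den) ∧ ∀ n, ¬ p ∣ (P.denom.coeff n).den

/-- `y` is a pole of the reduction of `P` modulo `p`. -/
def IsPole (p : ℕ) (P : RatFunc ℚ) (y : ZMod p) : Prop :=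
  (polyRed p P.denom).eval y = 0

instance (p : ℕ) (P : RatFunc ℚ) : DecidablePred (IsPole p P) := fun y =>
  inferInstanceAs (Decidable ((polyRed p P.denom).eval y = 0))

/-- Evaluation of the reduction of `P` modulo `p` at `y` (junk value `0` at poles). -/
def evalRed (p : ℕ) (P : RatFunc ℚ) (y : ZMod p) : ZMod p :=
  (polyRed p P.num).eval y * ((polyRed p P.denom).eval y)⁻¹

/-- A function is `1`-bounded if all its values have norm at most `1`. -/
def OneBounded {α : Type*} (f : α → ℂ) : Prop := ∀ x, ‖f x‖ ≤ 1

/-- The formal derivative of a rational function. -/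
def ratDeriv (P : RatFunc ℚ) : RatFunc ℚ :=
  algebraMap (Polynomial ℚ) (RatFunc ℚ)
      (Polynomial.derivative P.num * P.denom - P.num * Polynomial.derivative P.denom) /
    algebraMap (Polynomial ℚ) (RatFunc ℚ) (P.denom ^ 2)

/-- Substitution of the variable `y i` into a rational function `P ∈ ℚ(t)`, producing an
element of the rational function field `ℚ(y 0, …, y (n-1))`. -/
def substAt {n : ℕ} (P : RatFunc ℚ) (i : Fin n) : FractionRing (MvPolynomial (Fin n) ℚ) :=
  Polynomial.eval₂
      ((algebraMap (MvPolynomial (Fin n) ℚ) (FractionRing (MvPolynomial (Fin n) ℚ))).comp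
        MvPolynomial.C)
      (algebraMap (MvPolynomial (Fin n) ℚ) (FractionRing (MvPolynomial (Fin n) ℚ))
        (MvPolynomial.X i)) P.num /
    Polynomial.eval₂
      ((algebraMap (MvPolynomial (Fin n) ℚ) (FractionRing (MvPolynomial (Fin n) ℚ))).comp
        MvPolynomial.C)
      (algebraMap (MvPolynomial (Fin n) ℚ) (FractionRing (MvPolynomial (Fin n) ℚ))
        (MvPolynomial.X i)) P.denom

variable (p : ℕ) [NeZero p]

/-- The counting operator `𝔼_{x₁,x₂,y} f₀(x₁,x₂) f₁(x₁+P(y),x₂) f₂(x₁,x₂+Q(y))`,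
where the average in `y` avoids the poles of `P` and `Q` but is still normalized by `1/p`. -/
def cornerAvg (P Q : RatFunc ℚ) (f0 f1 f2 : ZMod p × ZMod p → ℂ) : ℂ :=
  (p : ℂ)⁻¹ ^ 3 * ∑ x1 : ZMod p, ∑ x2 : ZMod p, ∑ y : ZMod p,
    if ¬ IsPole p P y ∧ ¬ IsPole p Q y then
      f0 (x1, x2) * f1 (x1 + evalRed p P y, x2) * f2 (x1, x2 + evalRed p Q y)
    else 0

/-- The main term `𝔼_{x₁,x₂} f₀(x₁,x₂) · 𝔼_a f₁(a,x₂) · 𝔼_b f₂(x₁,b)`. -/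
def mainTerm (f0 f1 f2 : ZMod p × ZMod p → ℂ) : ℂ :=
  (p : ℂ)⁻¹ ^ 2 * ∑ x1 : ZMod p, ∑ x2 : ZMod p,
    f0 (x1, x2) * ((p : ℂ)⁻¹ * ∑ a : ZMod p, f1 (a, x2)) *
      ((p : ℂ)⁻¹ * ∑ b : ZMod p, f2 (x1, b))

/-- The `L^r` norm with respect to the uniform probability measure on `(ZMod p)²`. -/
def Lnorm (r : ℝ) (f : ZMod p × ZMod p → ℂ) : ℝ :=
  ((p : ℝ)⁻¹ ^ 2 * ∑ x : ZMod p × ZMod p, ‖f x‖ ^ r) ^ r⁻¹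

/-- The Gowers norm `‖f‖_{U²(0×F_p)}` along the second coordinate axis. -/
def U2vert (f : ZMod p × ZMod p → ℂ) : ℝ :=
  ((p : ℝ)⁻¹ ^ 4 * (∑ x : ZMod p × ZMod p, ∑ h : ZMod p, ∑ k : ZMod p,
      f x * (starRingEnd ℂ) (f (x + (0, h))) * (starRingEnd ℂ) (f (x + (0, k))) *
        f (x + (0, h + k))).re) ^ ((4:ℝ)⁻¹)

/-- The Gowers norm `‖f‖_{U²(F_p×0)}` along the first coordinate axis. -/
def U2horiz (f : ZMod p × ZMod p → ℂ) : ℝ :=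
  ((p : ℝ)⁻¹ ^ 4 * (∑ x : ZMod p × ZMod p, ∑ h : ZMod p, ∑ k : ZMod p,
      f x * (starRingEnd ℂ) (f (x + (h, 0))) * (starRingEnd ℂ) (f (x + (k, 0))) *
        f (x + (h + k, 0))).re) ^ ((4:ℝ)⁻¹)

/-- The additive character `e_p(x) = e^{2πix/p}` on `ZMod p`. -/
def ep (x : ZMod p) : ℂ := Complex.exp (2 * Real.pi * Complex.I * (x.val : ℂ) / (p : ℂ))

/-- `e(r) = e^{2πir}` for a real number `r`. -/
def eC (r : ℝ) : ℂ := Complex.exp (2 * Real.pi * Complex.I * (r : ℂ))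

/-- The Fourier transform `f̂(ξ) = 𝔼_x f(x) e_p(−x·ξ)` on `(ZMod p)²`. -/
def dft (f : ZMod p × ZMod p → ℂ) (ξ : ZMod p × ZMod p) : ℂ :=
  (p : ℂ)⁻¹ ^ 2 * ∑ x : ZMod p × ZMod p, f x * ep p (-(x.1 * ξ.1 + x.2 * ξ.2))

/-- `F₁(n₁,𝐡) = ∑_{n₂} Δ_{−𝐡} f̂₁(n₁,n₂)` where `Δ_h g(x) = g(x)·conj g(x+h)`. -/
def F1 (f : ZMod p × ZMod p → ℂ) (n1 : ZMod p) (h : ZMod p × ZMod p) : ℂ :=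
  ∑ n2 : ZMod p, dft p f (n1, n2) * (starRingEnd ℂ) (dft p f ((n1, n2) + -h))

/-- `F₂(m₂,𝐡) = ∑_{m₁} Δ_{𝐡} f̂₂(m₁,m₂)` where `Δ_h g(x) = g(x)·conj g(x+h)`. -/
def F2 (f : ZMod p × ZMod p → ℂ) (m2 : ZMod p) (h : ZMod p × ZMod p) : ℂ :=
  ∑ m1 : ZMod p, dft p f (m1, m2) * (starRingEnd ℂ) (dft p f ((m1, m2) + h))

/-- The `F_p`-points of the Roth variety for corners associated to `P, Q`:
tuples `(y₁,…,y₁₆)` (indexed here by `0,…,15`) avoiding all poles of `P` and `Q` and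
satisfying the ten defining equations. -/
def IsRothPoint (P Q : RatFunc ℚ) (y : Fin 16 → ZMod p) : Prop :=
  (∀ i, ¬ IsPole p P (y i)) ∧ (∀ i, ¬ IsPole p Q (y i)) ∧
  evalRed p P (y 0) - evalRed p P (y 2) - evalRed p P (y 8) + evalRed p P (y 10) = 0 ∧
  evalRed p P (y 1) - evalRed p P (y 3) - evalRed p P (y 9) + evalRed p P (y 11) = 0 ∧
  evalRed p P (y 4) - evalRed p P (y 6) - evalRed p P (y 12) + evalRed p P (y 14) = 0 ∧
  evalRed p P (y 5) - evalRed p P (y 7) - evalRed p P (y 13) + evalRed p P (y 15) = 0 ∧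
  evalRed p Q (y 0) - evalRed p Q (y 1) - evalRed p Q (y 8) + evalRed p Q (y 9) = 0 ∧
  evalRed p Q (y 2) - evalRed p Q (y 6) - evalRed p Q (y 10) + evalRed p Q (y 14) = 0 ∧
  evalRed p Q (y 3) - evalRed p Q (y 7) - evalRed p Q (y 11) + evalRed p Q (y 15) = 0 ∧
  evalRed p Q (y 4) - evalRed p Q (y 5) - evalRed p Q (y 12) + evalRed p Q (y 13) = 0 ∧
  evalRed p P (y 8) - evalRed p P (y 9) - evalRed p P (y 10) + evalRed p P (y 11) -
      evalRed p P (y 12) + evalRed p P (y 13) + evalRed p P (y 14) - evalRed p P (y 15) = 0 ∧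
  evalRed p Q (y 8) - evalRed p Q (y 9) - evalRed p Q (y 10) + evalRed p Q (y 11) -
      evalRed p Q (y 12) + evalRed p Q (y 13) + evalRed p Q (y 14) - evalRed p Q (y 15) = 0

/-- `|Y(F_p)|`, the number of `F_p`-points of the Roth variety for corners. -/
def rothCard (P Q : RatFunc ℚ) : ℕ :=
  Nat.card {y : Fin 16 → ZMod p // IsRothPoint p P Q y}

/-- `χ` is an eigenfunction with respect to the first coordinate:
`χ(x₁,x₂) = 1_E(x₂) e_p(φ(x₂)x₁) e(ψ(x₂))`. -/
def IsEigen1 (χ : ZMod p × ZMod p → ℂ) : Prop :=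
  ∃ (E : Finset (ZMod p)) (φ : ZMod p → ZMod p) (ψ : ZMod p → ℝ),
    ∀ x1 x2 : ZMod p,
      χ (x1, x2) = (if x2 ∈ E then 1 else 0) * ep p (φ x2 * x1) * eC (ψ x2)

/-- `χ` is an eigenfunction with respect to the second coordinate:
`χ(x₁,x₂) = 1_E(x₁) e_p(φ(x₁)x₂) e(ψ(x₁))`. -/
def IsEigen2 (χ : ZMod p × ZMod p → ℂ) : Prop :=
  ∃ (E : Finset (ZMod p)) (φ : ZMod p → ZMod p) (ψ : ZMod p → ℝ),
    ∀ x1 x2 : ZMod p,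
      χ (x1, x2) = (if x1 ∈ E then 1 else 0) * ep p (φ x1 * x2) * eC (ψ x1)

/-- The two-term counting operator `𝔼_{x₁,x₂,y} f₀(x₁,x₂) f₁(x₁+P(y),x₂)`. -/
def twoAvg1 (P : RatFunc ℚ) (f0 f1 : ZMod p × ZMod p → ℂ) : ℂ :=
  (p : ℂ)⁻¹ ^ 3 * ∑ x1 : ZMod p, ∑ x2 : ZMod p, ∑ y : ZMod p,
    if ¬ IsPole p P y then f0 (x1, x2) * f1 (x1 + evalRed p P y, x2) else 0

/-- The two-term counting operator `𝔼_{x₁,x₂,y} f₀(x₁,x₂) f₁(x₁,x₂+P(y))`. -/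
def twoAvg2 (P : RatFunc ℚ) (f0 f1 : ZMod p × ZMod p → ℂ) : ℂ :=
  (p : ℂ)⁻¹ ^ 3 * ∑ x1 : ZMod p, ∑ x2 : ZMod p, ∑ y : ZMod p,
    if ¬ IsPole p P y then f0 (x1, x2) * f1 (x1, x2 + evalRed p P y) else 0

/-- Orthogonality of the additive characters of `ZMod p`. -/
lemma sum_stdAddChar_mul (p : ℕ) [Fact p.Prime] (t : ZMod p) :
    ∑ ξ : ZMod p, ZMod.stdAddChar (ξ * t) = if t = 0 then (p : ℂ) else 0 := by
  have := AddChar.sum_mulShift t (ZMod.isPrimitive_stdAddChar p)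
  simpa using this

/-- Plancherel's inequality for functions bounded by `1`. -/
lemma sum_norm_sq_fourier_le (p : ℕ) [Fact p.Prime] (f : ZMod p → ℂ) (hf : OneBounded f) :
    ∑ ξ : ZMod p, ‖∑ x, f x * ZMod.stdAddChar (ξ * x)‖ ^ 2 ≤ (p : ℝ) ^ 2 := by
  have key : ((∑ ξ : ZMod p, ‖∑ x, f x * ZMod.stdAddChar (ξ * x)‖ ^ 2 : ℝ) : ℂ)
      = (p : ℂ) * ∑ x, ((‖f x‖ ^ 2 : ℝ) : ℂ) := by
    push_cast
    have e1 : ∀ ξ x y : ZMod p, f x * ZMod.stdAddChar (ξ * x) *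
        (starRingEnd ℂ) (f y * ZMod.stdAddChar (ξ * y)) =
        f x * (starRingEnd ℂ) (f y) * ZMod.stdAddChar (ξ * (x - y)) := by
      intro ξ x y
      rw [map_mul (starRingEnd ℂ), ← AddChar.map_neg_eq_conj, mul_sub, sub_eq_add_neg, AddChar.map_add_eq_mul]
      ring
    simp_rw [← Complex.mul_conj', map_sum, Finset.sum_mul_sum, e1]
    rw [Finset.sum_comm, Finset.mul_sum]
    refine Finset.sum_congr rfl fun x _ => ?_
    rw [Finset.sum_comm]
    simp only [← Finset.mul_sum, sum_stdAddChar_mul, sub_eq_zero, mul_ite, mul_zero]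
    simp
    ring
  have h2 : (∑ ξ : ZMod p, ‖∑ x, f x * ZMod.stdAddChar (ξ * x)‖ ^ 2 : ℝ)
      = (p : ℝ) * ∑ x, ‖f x‖ ^ 2 := by
    exact_mod_cast key
  rw [h2, sq]
  gcongr
  calc ∑ x, ‖f x‖ ^ 2 ≤ ∑ _x : ZMod p, (1 : ℝ) :=
        Finset.sum_le_sum fun x _ => pow_le_one₀ (norm_nonneg _) (hf x)
    _ = p := by simp [ZMod.card]

/-- A convolution kernel on `ZMod p` whose Fourier transform is bounded by `M` defines a bilinear
form bounded by `M * p` on functions bounded by `1`. -/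
lemma norm_sum_kernel_le (p : ℕ) [Fact p.Prime] (κ f0 f1 : ZMod p → ℂ) (M : ℝ)
    (hM : ∀ ξ : ZMod p, ‖∑ b, κ b * ZMod.stdAddChar (ξ * b)‖ ≤ M)
    (h0 : OneBounded f0) (h1 : OneBounded f1) :
    ‖∑ x, ∑ b, κ b * (f0 x * f1 (x + b))‖ ≤ M * p := by
  have hp : (0 : ℝ) < p := by exact_mod_cast (Fact.out : p.Prime).pos
  have hpC : (p : ℂ) ≠ 0 := by exact_mod_cast hp.ne'
  have hM0 : 0 ≤ M := (norm_nonneg _).trans (hM 0)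
  set A : ZMod p → ℂ := fun ξ => ∑ x, f0 x * ZMod.stdAddChar (ξ * x) with hA
  set B : ZMod p → ℂ := fun ξ => ∑ x, f1 x * ZMod.stdAddChar (ξ * x) with hB
  set K : ZMod p → ℂ := fun ξ => ∑ x, κ x * ZMod.stdAddChar (ξ * x) with hK
  have key : ∑ ξ, A ξ * B (-ξ) * K ξ = (p : ℂ) * ∑ x, ∑ b, κ b * (f0 x * f1 (x + b)) := by
    have e1 : ∀ ξ, A ξ * B (-ξ) * K ξ =
        ∑ x, ∑ b, ∑ y, κ b * f0 x * f1 y * ZMod.stdAddChar (ξ * (x + b - y)) := by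
      intro ξ
      have : ∀ x b y : ZMod p, (ZMod.stdAddChar (ξ * (x + b - y)) : ℂ) =
        ZMod.stdAddChar (ξ * x) * ZMod.stdAddChar (ξ * b) * ZMod.stdAddChar (-ξ * y) := by
        intro x b y
        rw [← AddChar.map_add_eq_mul, ← AddChar.map_add_eq_mul]
        congr 1; ring
      simp only [hA, hB, hK, this]
      rw [mul_assoc, Finset.sum_mul]
      refine Finset.sum_congr rfl fun x _ => ?_
      rw [Finset.sum_mul_sum, Finset.sum_comm]
      simp only [Finset.mul_sum]
      refine Finset.sum_congr rfl fun b _ => Finset.sum_congr rfl fun y _ => ?_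
      ring
    simp only [e1]
    rw [Finset.sum_comm, Finset.mul_sum]
    refine Finset.sum_congr rfl fun x _ => ?_
    rw [Finset.sum_comm, Finset.mul_sum]
    refine Finset.sum_congr rfl fun b _ => ?_
    rw [Finset.sum_comm]
    simp only [← Finset.mul_sum, sum_stdAddChar_mul, sub_eq_zero, mul_ite, mul_zero]
    simp
    ring
  have hbd : ‖∑ ξ, A ξ * B (-ξ) * K ξ‖ ≤ M * (p : ℝ) ^ 2 := by
    have hB' : ∑ ξ, ‖B (-ξ)‖ ^ 2 ≤ (p : ℝ) ^ 2 := by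
      refine (Equiv.sum_comp (Equiv.neg (ZMod p)) (fun ξ => ‖B ξ‖ ^ 2)).trans_le ?_
      exact sum_norm_sq_fourier_le p f1 h1
    have hA' : ∑ ξ, ‖A ξ‖ ^ 2 ≤ (p : ℝ) ^ 2 := sum_norm_sq_fourier_le p f0 h0
    calc ‖∑ ξ, A ξ * B (-ξ) * K ξ‖ ≤ ∑ ξ, ((‖A ξ‖ ^ 2 + ‖B (-ξ)‖ ^ 2) / 2) * M := by
          refine (norm_sum_le _ _).trans (Finset.sum_le_sum fun ξ _ => ?_)
          rw [norm_mul, norm_mul]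
          gcongr
          · nlinarith [sq_nonneg (‖A ξ‖ - ‖B (-ξ)‖)]
          · exact hM ξ
      _ = ((∑ ξ, ‖A ξ‖ ^ 2 + ∑ ξ, ‖B (-ξ)‖ ^ 2) / 2) * M := by
          rw [← Finset.sum_add_distrib, Finset.sum_div, Finset.sum_mul]
      _ ≤ ((p : ℝ) ^ 2 + (p : ℝ) ^ 2) / 2 * M := by gcongr
      _ = _ := by ring
  rw [key, norm_mul, Complex.norm_natCast] at hbd
  have : (p : ℝ) * ‖∑ x, ∑ b, κ b * (f0 x * f1 (x + b))‖ ≤ p * (M * p) := by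
    calc _ ≤ _ := hbd
      _ = _ := by ring
  exact le_of_mul_le_mul_left this hp

/-- If the logarithmic derivative of a polynomial `L` with `L(0) = 1` has power series coefficients
of size `O(ρ ^ n)`, then `L` has no zero in the open disc of radius `ρ⁻¹`. -/
lemma inv_le_norm_of_isRoot (L : ℂ[X]) (hL : L.coeff 0 = 1) (S : ℕ → ℂ) (B ρ : ℝ) (hρ : 0 < ρ)
    (hS : ∀ n, 1 ≤ n → ‖S n‖ ≤ B * ρ ^ n)
    (hrec : ∀ n : ℕ, (n + 1 : ℂ) * L.coeff (n + 1) =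
      ∑ j ∈ Finset.range (n + 1), S (j + 1) * L.coeff (n - j))
    (t : ℂ) (ht : L.IsRoot t) : ρ⁻¹ ≤ ‖t‖ := by
  by_contra! hlt
  have hB : 0 ≤ B := by
    have := (norm_nonneg _).trans (hS 1 le_rfl)
    rw [pow_one] at this
    exact nonneg_of_mul_nonneg_left this hρ
  have hL0 : L ≠ 0 := by rintro rfl; simp at hL
  -- boundedness of the logarithmic derivative
  obtain ⟨r, hr1, hr2⟩ := exists_between hlt
  have hr0 : 0 ≤ r := (norm_nonneg _).trans hr1.le
  have hq1 : ρ * r < 1 := by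
    calc ρ * r < ρ * ρ⁻¹ := by gcongr
      _ = 1 := mul_inv_cancel₀ hρ.ne'
  have hq0 : 0 ≤ ρ * r := by positivity
  have hgeom : Summable fun n : ℕ => B * ρ * (ρ * r) ^ n :=
    (summable_geometric_of_lt_one hq0 hq1).mul_left _
  have hterm : ∀ z : ℂ, ‖z‖ ≤ r → ∀ n : ℕ, ‖S (n + 1) * z ^ n‖ ≤ B * ρ * (ρ * r) ^ n := by
    intro z hz n
    rw [norm_mul, norm_pow]
    calc ‖S (n + 1)‖ * ‖z‖ ^ n ≤ (B * ρ ^ (n + 1)) * r ^ n := by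
          gcongr
          exact hS _ (by omega)
      _ = _ := by ring
  have hsummable : ∀ z : ℂ, ‖z‖ ≤ r → Summable fun n : ℕ => ‖S (n + 1) * z ^ n‖ := fun z hz =>
    hgeom.of_nonneg_of_le (fun _ => norm_nonneg _) (hterm z hz)
  set s : ℂ → ℂ := fun z => ∑' n : ℕ, S (n + 1) * z ^ n with hs
  set D : ℝ := ∑' n : ℕ, B * ρ * (ρ * r) ^ n with hD
  have hsD : ∀ z : ℂ, ‖z‖ ≤ r → ‖s z‖ ≤ D := fun z hz =>
    (norm_tsum_le_tsum_norm (hsummable z hz)).trans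
      ((hsummable z hz).tsum_le_tsum (hterm z hz) hgeom)
  have hpolysum : ∀ (P : ℂ[X]) (z : ℂ), HasSum (fun n => P.coeff n * z ^ n) (P.eval z) := by
    intro P z
    rw [eval_eq_sum_range]
    refine hasSum_sum_of_ne_finset_zero fun n hn => ?_
    rw [coeff_eq_zero_of_natDegree_lt (by simpa using hn), zero_mul]
  have hderiv : ∀ z : ℂ, ‖z‖ ≤ r → L.derivative.eval z = s z * L.eval z := by
    intro z hz
    have hLs : Summable fun n => ‖L.coeff n * z ^ n‖ := by
      refine summable_of_ne_finset_zero (s := Finset.range (L.natDegree + 1)) fun n hn => ?_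
      rw [coeff_eq_zero_of_natDegree_lt (by simpa using hn)]; simp
    rw [← (hpolysum L z).tsum_eq, hs,
      tsum_mul_tsum_eq_tsum_sum_range_of_summable_norm (hsummable z hz) hLs,
      ← (hpolysum (derivative L) z).tsum_eq]
    congr 1
    ext n
    rw [coeff_derivative, mul_comm (L.coeff (n + 1)), hrec n, Finset.sum_mul]
    refine Finset.sum_congr rfl fun j hj => ?_
    have hj' : j ≤ n := by simpa [Nat.lt_succ_iff] using hj
    have hz' : z ^ n = z ^ j * z ^ (n - j) := by rw [← pow_add, Nat.add_sub_cancel' hj']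
    rw [hz']
    ring
  -- vanishing orders
  obtain ⟨M, hM, hMt⟩ := exists_eq_pow_rootMultiplicity_mul_and_not_dvd L hL0 t
  set k := L.rootMultiplicity t with hk
  have hk1 : 0 < k := (rootMultiplicity_pos hL0).2 ht
  obtain ⟨e, he⟩ := Nat.exists_eq_succ_of_ne_zero hk1.ne'
  have hMt' : M.eval t ≠ 0 := fun h => hMt (dvd_iff_isRoot.2 h)
  have hid : ∀ z : ℂ, ‖z‖ ≤ r → z ≠ t →
      (k : ℂ) * M.eval z + (z - t) * M.derivative.eval z = (z - t) * (s z * M.eval z) := by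
    intro z hz hzt
    have h := hderiv z hz
    rw [hM, he, derivative_mul, derivative_X_sub_C_pow] at h
    simp only [eval_add, eval_mul, eval_pow, eval_sub, eval_X, eval_C, Nat.succ_eq_add_one,
      Nat.add_sub_cancel] at h
    have hne : (z - t) ^ e ≠ 0 := pow_ne_zero _ (sub_ne_zero.2 hzt)
    apply mul_left_cancel₀ hne
    rw [he]
    simp only [Nat.succ_eq_add_one]
    linear_combination h
  have htend1 : Filter.Tendsto (fun z : ℂ => (k : ℂ) * M.eval z + (z - t) * M.derivative.eval z)
      (nhdsWithin t {t}ᶜ) (nhds ((k : ℂ) * M.eval t + (t - t) * M.derivative.eval t)) := by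
    refine Filter.Tendsto.mono_left (Continuous.tendsto ?_ t) nhdsWithin_le_nhds
    fun_prop
  have hnear : ∀ᶠ z in nhdsWithin t {t}ᶜ, ‖z‖ ≤ r ∧ z ≠ t := by
    refine Filter.Eventually.and ?_ self_mem_nhdsWithin
    refine Filter.Eventually.filter_mono nhdsWithin_le_nhds ?_
    exact (continuous_norm.tendsto t).eventually_le_const hr1
  have htend2 : Filter.Tendsto (fun z : ℂ => (z - t) * (s z * M.eval z))
      (nhdsWithin t {t}ᶜ) (nhds 0) := by
    have hz : Filter.Tendsto (fun z : ℂ => ‖z - t‖ * (D * ‖M.eval z‖))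
        (nhdsWithin t {t}ᶜ) (nhds 0) := by
      have : Continuous fun z : ℂ => ‖z - t‖ * (D * ‖M.eval z‖) := by fun_prop
      have h2 := (this.tendsto t).mono_left (nhdsWithin_le_nhds (s := {t}ᶜ))
      simpa using h2
    refine squeeze_zero_norm' ?_ hz
    filter_upwards [hnear] with z hz
    rw [norm_mul, norm_mul]
    gcongr
    exact hsD z hz.1
  have heq := tendsto_nhds_unique
    (htend1.congr' (hnear.mono fun z hz => hid z hz.1 hz.2)) htend2
  simp only [sub_self, zero_mul, add_zero] at heq
  have hk0 : (k : ℂ) ≠ 0 := by exact_mod_cast hk1.ne'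
  exact (mul_ne_zero hk0 hMt') heq

/-- The first power sum of the reciprocal zeros of an `L`-polynomial of degree less than `N`. -/
lemma norm_le_of_newton (c S : ℕ → ℂ) (N : ℕ) (B ρ : ℝ) (hρ : 0 < ρ) (hc0 : c 0 = 1)
    (hcN : ∀ n, N < n → c n = 0) (hN : 1 ≤ N)
    (hS : ∀ n, 1 ≤ n → ‖S n‖ ≤ B * ρ ^ n)
    (hrec : ∀ n : ℕ, (n + 1 : ℂ) * c (n + 1) = ∑ j ∈ Finset.range (n + 1), S (j + 1) * c (n - j)) :
    ‖S 1‖ ≤ N * ρ := by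
  set Q : ℂ[X] := ∑ i ∈ Finset.range (N + 1), C (c (N - i)) * X ^ i with hQ
  set L : ℂ[X] := ∑ i ∈ Finset.range (N + 1), C (c i) * X ^ i with hL
  have hLc : ∀ n, L.coeff n = c n := by
    intro n
    simp only [hL, finsetSum_coeff, coeff_C_mul, coeff_X_pow]
    by_cases hn : n < N + 1
    · simp [hn]
    · simp [hn, hcN n (by omega)]
  have hQcoeff : ∀ n, n ≤ N → Q.coeff n = c (N - n) := by
    intro n hn
    simp only [hQ, finsetSum_coeff, coeff_C_mul, coeff_X_pow]
    simp [Nat.lt_succ_of_le hn]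
  have hQle : Q.natDegree ≤ N :=
    natDegree_sum_le_of_forall_le _ _ fun i hi =>
      (natDegree_C_mul_X_pow_le _ _).trans (by simpa [Nat.lt_succ_iff] using hi)
  have hQN : Q.coeff N = 1 := by rw [hQcoeff N le_rfl, Nat.sub_self, hc0]
  have hQm : Q.Monic := monic_of_natDegree_le_of_coeff_eq_one N hQle hQN
  have hQd : Q.natDegree = N :=
    le_antisymm hQle (le_natDegree_of_ne_zero (by rw [hQN]; exact one_ne_zero))
  have hQc : Q.nextCoeff = c 1 := by
    rw [nextCoeff_of_natDegree_pos (by omega), hQd, hQcoeff _ (by omega)]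
    congr 1; omega
  have hQev : ∀ z : ℂ, z ≠ 0 → Q.eval z = z ^ N * L.eval z⁻¹ := by
    intro z hz
    simp only [hQ, hL, eval_finsetSum, eval_mul, eval_C, eval_pow, eval_X]
    rw [← Finset.sum_range_reflect, Finset.mul_sum]
    refine Finset.sum_congr rfl fun i hi => ?_
    have hi' : i ≤ N := by simpa [Nat.lt_succ_iff] using hi
    have h1 : N + 1 - 1 - i = N - i := by omega
    rw [h1, Nat.sub_sub_self hi', inv_pow, ← div_eq_mul_inv, mul_comm, div_eq_mul_inv,
      mul_comm (c i), ← mul_assoc, ← div_eq_mul_inv, pow_sub₀ _ hz hi', div_eq_mul_inv]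
  have hroots : ∀ z ∈ Q.roots, ‖z‖ ≤ ρ := by
    intro z hz
    rcases eq_or_ne z 0 with rfl | hz0
    · simpa using hρ.le
    have h1 : Q.eval z = 0 := isRoot_of_mem_roots hz
    rw [hQev z hz0] at h1
    have h2 : L.IsRoot z⁻¹ := (mul_eq_zero.1 h1).resolve_left (pow_ne_zero _ hz0)
    have h3 := inv_le_norm_of_isRoot L (by rw [hLc, hc0]) S B ρ hρ hS
      (by simpa only [hLc] using hrec) _ h2
    rw [norm_inv] at h3
    exact (inv_le_inv₀ hρ (norm_pos_iff.2 hz0)).1 h3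
  have hS1 : S 1 = c 1 := by
    have := hrec 0
    simp [hc0] at this
    exact this.symm
  have hsum := (IsAlgClosed.splits Q).nextCoeff_eq_neg_sum_roots_of_monic hQm
  rw [hS1, ← hQc, hsum, norm_neg]
  have hcard : Q.roots.card ≤ N := hQd ▸ Q.card_roots'
  calc ‖Q.roots.sum‖ ≤ (Q.roots.map norm).sum := norm_multiset_sum_le _
    _ ≤ (Q.roots.map norm).card • ρ := by
        refine Multiset.sum_le_card_nsmul _ _ ?_
        intro x hx
        obtain ⟨z, hz, rfl⟩ := Multiset.mem_map.1 hx
        exact hroots z hz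
    _ ≤ N * ρ := by
        rw [Multiset.card_map, nsmul_eq_mul]
        gcongr

lemma resultant_prod_X_sub_C {R : Type*} [CommRing R] (s : Multiset R) (H : R[X]) (n : ℕ)
    (hn : H.natDegree ≤ n) :
    resultant (s.map fun a => X - C a).prod H s.card n = (s.map fun a => H.eval a).prod := by
  nontriviality R
  induction s using Multiset.induction with
  | empty => simp
  | cons a s ih =>
    have h1 : (X - C a : R[X]).natDegree = 1 := natDegree_X_sub_C a
    have h2 : (s.map fun a => (X - C a : R[X])).prod.natDegree = s.card :=
      natDegree_multiset_prod_X_sub_C_eq_card s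
    rw [Multiset.map_cons, Multiset.prod_cons, Multiset.map_cons, Multiset.prod_cons,
      Multiset.card_cons, ← ih]
    have h3 := resultant_mul_left (X - C a) (s.map fun a => (X - C a : R[X])).prod H n hn
    rw [h1, h2, resultant_X_sub_C_left _ _ _ hn, add_comm] at h3
    exact h3

lemma prod_add_eps_mul {K : Type*} [Field K] (s : Multiset K) (f g : K → K)
    (hg : ∀ a ∈ s, g a ≠ 0) :
    (s.map fun a => (TrivSqZeroExt.inl (g a) + DualNumber.eps * TrivSqZeroExt.inl (f a) :
      DualNumber K)).prod =
      TrivSqZeroExt.inl (s.map g).prod *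
        (1 + DualNumber.eps * TrivSqZeroExt.inl (s.map fun a => f a / g a).sum) := by
  induction s using Multiset.induction with
  | empty => simp
  | cons a s ih =>
    have ha : g a ≠ 0 := hg a (Multiset.mem_cons_self _ _)
    rw [Multiset.map_cons, Multiset.prod_cons, ih fun b hb => hg b (Multiset.mem_cons_of_mem hb)]
    ext
    · simp
    · simp
      field_simp
      ring

lemma sum_roots_congr {K : Type*} [Field K] [IsAlgClosed K] (F G h h' q : K[X]) (hG : G.Monic)
    (hFG : F.degree < G.degree) (hh : h.Monic) (hh' : h'.Monic) (hq : h = h' + G ^ 2 * q)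
    (h0 : ∀ a ∈ h.roots, G.eval a ≠ 0) (h0' : ∀ a ∈ h'.roots, G.eval a ≠ 0) :
    (h.roots.map fun a => F.eval a / G.eval a).sum =
      (h'.roots.map fun a => F.eval a / G.eval a).sum := by
  let ι : K →+* DualNumber K := TrivSqZeroExt.inlHom K K
  have hι : ∀ a, ι a = TrivSqZeroExt.inl a := fun _ => rfl
  set H : (DualNumber K)[X] := G.map ι + C DualNumber.eps * F.map ι with hH
  have hdeg : (C DualNumber.eps * F.map ι).degree < (G.map ι).degree := by
    rw [hG.degree_map]
    refine lt_of_le_of_lt ((degree_mul_le _ _).trans ?_) hFG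
    calc _ ≤ 0 + F.degree := add_le_add degree_C_le degree_map_le
      _ = _ := zero_add _
  have hHm : H.Monic := (hG.map ι).add_of_left hdeg
  have hHd : H.natDegree = G.natDegree := by
    rw [hH, natDegree_add_eq_left_of_degree_lt hdeg, hG.natDegree_map]
  have key : ∀ (h : K[X]), h.Monic → (∀ a ∈ h.roots, G.eval a ≠ 0) → ∀ N k, h.natDegree + k = N →
      resultant (h.map ι) H N G.natDegree = (-1) ^ (G.natDegree * k) *
        (TrivSqZeroExt.inl (h.roots.map fun a => G.eval a).prod *
        (1 + DualNumber.eps *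
          TrivSqZeroExt.inl (h.roots.map fun a => F.eval a / G.eval a).sum)) := by
    intro h hh h0 N k hN
    rw [← hN, resultant_add_left_deg _ _ _ _ _ (hh.natDegree_map ι).le, ← hHd, hHm.coeff_natDegree,
      one_pow, mul_one, ← prod_add_eps_mul _ (fun a => F.eval a) (fun a => G.eval a) h0]
    congr 1
    have e1 : h.map ι = ((h.roots.map ι).map fun a => X - C a).prod := by
      conv_lhs => rw [(IsAlgClosed.splits h).eq_prod_roots_of_monic hh, Polynomial.map_multiset_prod]
      simp
    have e2 : h.natDegree = (h.roots.map ι).card := by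
      rw [Multiset.card_map, (IsAlgClosed.splits h).natDegree_eq_card_roots]
    rw [e1, e2, resultant_prod_X_sub_C _ _ _ le_rfl, Multiset.map_map]
    congr 1
    refine Multiset.map_congr rfl fun a _ => ?_
    simp [hH, eval_map, ← hι, eval₂_at_apply]
  set N := h.natDegree + h'.natDegree + G.natDegree with hN
  have k1 := key h hh h0 N (h'.natDegree + G.natDegree) (by omega)
  have k2 := key h' hh' h0' N (h.natDegree + G.natDegree) (by omega)
  have k3 : resultant (h.map ι) H N G.natDegree = resultant (h'.map ι) H N G.natDegree := by
    have e : h.map ι = h'.map ι + H * ((G.map ι - C DualNumber.eps * F.map ι) * q.map ι) := by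
      have hε : (C DualNumber.eps : (DualNumber K)[X]) * C DualNumber.eps = 0 := by
        rw [← C_mul, DualNumber.eps_mul_eps, C_0]
      rw [hq, hH]
      simp only [Polynomial.map_add, Polynomial.map_mul, Polynomial.map_pow]
      linear_combination (F.map ι) ^ 2 * (q.map ι) * hε
    rw [e, resultant_add_mul_left _ _ _ _ _ ?_ hHd.le]
    rcases eq_or_ne q 0 with rfl | hq0
    · simp; omega
    have d1 : (G ^ 2 * q).natDegree = 2 * G.natDegree + q.natDegree := by
      rw [natDegree_mul (pow_ne_zero _ hG.ne_zero) hq0, natDegree_pow]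
    have d2 : (G ^ 2 * q).natDegree ≤ max h.natDegree h'.natDegree := by
      have : G ^ 2 * q = h - h' := by rw [hq]; ring
      rw [this]; exact natDegree_sub_le _ _
    have d3 : (G.map ι - C DualNumber.eps * F.map ι).natDegree ≤ G.natDegree := by
      refine (natDegree_sub_le _ _).trans (max_le natDegree_map_le ?_)
      exact (natDegree_le_natDegree hdeg.le).trans natDegree_map_le
    have d4 := natDegree_mul_le (p := G.map ι - C DualNumber.eps * F.map ι) (q := q.map ι)
    have d5 : (q.map ι).natDegree ≤ q.natDegree := natDegree_map_le
    omega
  rw [k1, k2] at k3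
  have hp : (h.roots.map fun a => G.eval a).prod ≠ 0 := by
    rw [Ne, Multiset.prod_eq_zero_iff]
    rintro hx
    obtain ⟨a, ha, h⟩ := Multiset.mem_map.1 hx
    exact h0 a ha h
  have f1 := congrArg TrivSqZeroExt.fst k3
  have f2 := congrArg TrivSqZeroExt.snd k3
  have hs : ∀ n : ℕ, ((-1) ^ n : DualNumber K) = TrivSqZeroExt.inl ((-1) ^ n) := by
    intro n
    change _ = ι _
    simp
  rw [hs, hs] at f1 f2
  simp at f1 f2
  refine mul_left_cancel₀ (mul_ne_zero (pow_ne_zero (G.natDegree * (h'.natDegree + G.natDegree))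
    (by simp : (-1 : K) ≠ 0)) hp) ?_
  linear_combination f2 - (h'.roots.map fun a => F.eval a / G.eval a).sum * f1

section Frobenius
variable (p : ℕ) [Fact p.Prime]

lemma pow_prime_pow_eq_self_iff (x : AlgebraicClosure (ZMod p)) (n : ℕ) :
    x ^ p ^ n = x ↔ (minpoly (ZMod p) x).natDegree ∣ n := by
  have hx : IsIntegral (ZMod p) x := Algebra.IsIntegral.isIntegral x
  rw [(minpoly.irreducible hx).natDegree_dvd_iff_dvd_X_pow_card_pow_sub_X,
    minpoly.dvd_iff]
  simp [sub_eq_zero]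

lemma aroots_minpoly (x : AlgebraicClosure (ZMod p)) :
    (minpoly (ZMod p) x).aroots (AlgebraicClosure (ZMod p)) =
      (Multiset.range (minpoly (ZMod p) x).natDegree).map fun i => x ^ p ^ i := by
  have hx : IsIntegral (ZMod p) x := Algebra.IsIntegral.isIntegral x
  have hne : minpoly (ZMod p) x ≠ 0 := minpoly.ne_zero hx
  set d := (minpoly (ZMod p) x).natDegree with hd
  have hnd : ((Multiset.range d).map fun i => x ^ p ^ i).Nodup := by
    refine (Multiset.nodup_map_iff_inj_on (Multiset.nodup_range d)).2 ?_
    have key : ∀ i j, i ≤ j → j < d → x ^ p ^ i = x ^ p ^ j → i = j := by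
      intro i j hij hj h
      have h1 : x ^ p ^ (j - i) = x := by
        have hinj := (iterateFrobenius_inj (AlgebraicClosure (ZMod p)) p i)
        apply hinj
        rw [iterateFrobenius_def, iterateFrobenius_def, ← pow_mul, ← pow_add,
          Nat.sub_add_cancel hij, h]
      rw [pow_prime_pow_eq_self_iff] at h1
      have := Nat.eq_zero_of_dvd_of_lt h1 (by omega)
      omega
    intro i hi j hj h
    rw [Multiset.mem_range] at hi hj
    rcases le_total i j with hij | hij
    · exact key i j hij hj h
    · exact (key j i hij hi h.symm).symm
  symm
  refine Multiset.eq_of_le_of_card_le ?_ ?_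
  · refine (Multiset.le_iff_subset hnd).2 fun y hy => ?_
    obtain ⟨i, -, rfl⟩ := Multiset.mem_map.1 hy
    rw [mem_aroots]
    refine ⟨hne, ?_⟩
    have h1 := congrArg (fun y => y ^ p ^ i) (minpoly.aeval (ZMod p) x)
    rw [zero_pow (pow_ne_zero _ (Fact.out : p.Prime).ne_zero)] at h1
    rw [← h1]
    simp only [aeval_def, eval₂_eq_sum_range, ← iterateFrobenius_def, map_sum, map_mul, map_pow]
    simp only [iterateFrobenius_def, ← map_pow, ZMod.pow_card_pow]
  · rw [Multiset.card_map, Multiset.card_range]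
    exact (card_roots' _).trans (natDegree_map_le.trans le_rfl)

open Classical in
lemma count_aroots_minpoly (x : AlgebraicClosure (ZMod p)) :
    ((minpoly (ZMod p) x).aroots (AlgebraicClosure (ZMod p))).count x = 1 := by
  have hx : IsIntegral (ZMod p) x := Algebra.IsIntegral.isIntegral x
  refine Multiset.count_eq_one_of_mem ?_ ?_
  · refine nodup_roots ?_
    exact (PerfectField.separable_of_irreducible (minpoly.irreducible hx)).map
  · rw [mem_aroots]; exact ⟨minpoly.ne_zero hx, minpoly.aeval _ _⟩

open Classical in
lemma minpoly_pow_dvd_iff (x : AlgebraicClosure (ZMod p))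
    (h : (ZMod p)[X]) (hh : h ≠ 0) (e : ℕ) :
    minpoly (ZMod p) x ^ e ∣ h ↔ e ≤ (h.aroots (AlgebraicClosure (ZMod p))).count x := by
  have hx : IsIntegral (ZMod p) x := Algebra.IsIntegral.isIntegral x
  have hc : ∀ (m : ℕ) (q : (ZMod p)[X]), q ≠ 0 →
      ((minpoly (ZMod p) x ^ m * q).aroots (AlgebraicClosure (ZMod p))).count x =
        m + (q.aroots (AlgebraicClosure (ZMod p))).count x := by
    intro m q hq
    rw [aroots_mul (mul_ne_zero (pow_ne_zero _ (minpoly.ne_zero hx)) hq), aroots_pow,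
      Multiset.count_add, Multiset.count_nsmul, count_aroots_minpoly, mul_one]
  constructor
  · rintro ⟨q, rfl⟩
    rw [hc e q (by rintro rfl; simp at hh)]
    omega
  · intro he
    obtain ⟨q, hq, hnd⟩ := 
      (FiniteMultiplicity.of_not_isUnit
        (minpoly.irreducible hx).not_isUnit hh).exists_eq_pow_mul_and_not_dvd
    have hq0 : q ≠ 0 := by rintro rfl; simp at hq; exact hh hq
    set m := multiplicity (minpoly (ZMod p) x) h
    have h1 := hc m q hq0
    rw [← hq] at h1
    have h2 : (q.aroots (AlgebraicClosure (ZMod p))).count x = 0 := by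
      rw [Multiset.count_eq_zero, mem_aroots]
      rintro ⟨-, h⟩
      exact hnd (minpoly.dvd _ _ h)
    rw [hq]
    exact (pow_dvd_pow _ (by omega)).mul_right _

open Classical in
/-- Counting the prime powers dividing a polynomial, weighted by degrees. -/
lemma card_minpoly_pow_dvd (x : AlgebraicClosure (ZMod p))
    (h : (ZMod p)[X]) (hh : h ≠ 0) :
    ((Finset.range h.natDegree).filter fun j => x ^ p ^ (j + 1) = x ∧
      minpoly (ZMod p) x ^ ((j + 1) / (minpoly (ZMod p) x).natDegree) ∣ h).card =
      (h.aroots (AlgebraicClosure (ZMod p))).count x := by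
  have hx : IsIntegral (ZMod p) x := Algebra.IsIntegral.isIntegral x
  set d := (minpoly (ZMod p) x).natDegree with hd
  have hd0 : 0 < d := minpoly.natDegree_pos hx
  set m := (h.aroots (AlgebraicClosure (ZMod p))).count x with hm
  rw [← Finset.card_range m]
  symm
  refine Finset.card_bij (fun e _ => d * (e + 1) - 1) ?_ ?_ ?_
  · intro e he
    have he' : e + 1 ≤ m := by simpa using he
    have h1 : d * (e + 1) - 1 + 1 = d * (e + 1) := Nat.sub_add_cancel (Nat.mul_pos hd0 (Nat.succ_pos _))
    have h2 := (minpoly_pow_dvd_iff p x h hh (e + 1)).2 he'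
    have h3 := natDegree_le_of_dvd h2 hh
    rw [natDegree_pow, ← hd, mul_comm] at h3
    rw [Finset.mem_filter, Finset.mem_range, h1, pow_prime_pow_eq_self_iff, ← hd,
      Nat.mul_div_cancel_left _ hd0]
    exact ⟨by omega, dvd_mul_right _ _, h2⟩
  · intro a _ b _ hab
    have h1 : ∀ e, d * (e + 1) - 1 + 1 = d * (e + 1) := fun e => Nat.sub_add_cancel (Nat.mul_pos hd0 (Nat.succ_pos _))
    have h2 : d * (a + 1) = d * (b + 1) := by rw [← h1 a, ← h1 b, hab]
    have := Nat.eq_of_mul_eq_mul_left hd0 h2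
    omega
  · intro j hj
    rw [Finset.mem_filter, pow_prime_pow_eq_self_iff, ← hd] at hj
    obtain ⟨hj1, ⟨e, he⟩, h3⟩ := hj
    rw [he, Nat.mul_div_cancel_left _ hd0, minpoly_pow_dvd_iff p x h hh] at h3
    have he0 : e ≠ 0 := by rintro rfl; omega
    refine ⟨e - 1, by rw [Finset.mem_range]; omega, ?_⟩
    rw [Nat.sub_add_cancel (by omega), ← he]
    omega

end Frobenius

section LFunction
variable (p : ℕ) [Fact p.Prime]

open Classical in
/-- The points of the algebraic closure that are fixed by the `n`-th power of Frobenius. -/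
def frobPoints (n : ℕ) : Finset (AlgebraicClosure (ZMod p)) :=
  (X ^ p ^ n - X : (AlgebraicClosure (ZMod p))[X]).roots.toFinset

lemma mem_frobPoints {n : ℕ} (hn : n ≠ 0) (x : AlgebraicClosure (ZMod p)) :
    x ∈ frobPoints p n ↔ x ^ p ^ n = x := by
  classical
  rw [frobPoints, Multiset.mem_toFinset, mem_roots
    (FiniteField.X_pow_card_pow_sub_X_ne_zero _ hn (Fact.out : p.Prime).one_lt)]
  simp [sub_eq_zero]

lemma card_frobPoints {n : ℕ} (hn : n ≠ 0) : (frobPoints p n).card = p ^ n := by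
  classical
  have hs : (X ^ p ^ n - X : (AlgebraicClosure (ZMod p))[X]).Separable :=
    galois_poly_separable p (p ^ n) (dvd_pow_self p hn)
  rw [frobPoints, Multiset.toFinset_card_of_nodup (nodup_roots hs),
    ← (IsAlgClosed.splits _).natDegree_eq_card_roots,
    FiniteField.X_pow_card_pow_sub_X_natDegree_eq _ hn (Fact.out : p.Prime).one_lt]

lemma finite_monic_natDegree (n : ℕ) : {h : (ZMod p)[X] | h.Monic ∧ h.natDegree = n}.Finite := by
  refine (Set.finite_range fun a : Fin (n + 1) → ZMod p =>
    ∑ i : Fin (n + 1), C (a i) * X ^ (i : ℕ)).subset ?_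
  rintro h ⟨-, hn⟩
  refine ⟨fun i => h.coeff i, ?_⟩
  conv_rhs => rw [h.as_sum_range_C_mul_X_pow, hn]
  rw [Finset.sum_range]

/-- The monic polynomials of degree `n` over `ZMod p`. -/
def monicPolys (n : ℕ) : Finset (ZMod p)[X] := (finite_monic_natDegree p n).toFinset

lemma mem_monicPolys {n : ℕ} {h : (ZMod p)[X]} :
    h ∈ monicPolys p n ↔ h.Monic ∧ h.natDegree = n := by
  simp [monicPolys]

variable {p}
variable (F G : (ZMod p)[X]) (Ψ : AddChar (AlgebraicClosure (ZMod p)) ℂ)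

/-- The value of the fraction `F / G` at a point of the algebraic closure. -/
def fracVal (x : AlgebraicClosure (ZMod p)) : AlgebraicClosure (ZMod p) := aeval x F / aeval x G

open Classical in
/-- The completely multiplicative function `h ↦ Ψ(∑_{h(α) = 0} F(α) / G(α))`. -/
def lam (h : (ZMod p)[X]) : ℂ :=
  if IsCoprime h G then Ψ ((h.aroots (AlgebraicClosure (ZMod p))).map (fracVal F G)).sum else 0

open Classical in
/-- The exponential sum over the field with `p ^ n` elements. -/
def expSum (n : ℕ) : ℂ :=
  ∑ x ∈ frobPoints p n, if aeval x G ≠ 0 then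
    Ψ (∑ i ∈ Finset.range n, fracVal F G x ^ p ^ i) else 0

lemma lam_one : lam F G Ψ 1 = 1 := by
  simp [lam, isCoprime_one_left]

lemma lam_mul {h₁ h₂ : (ZMod p)[X]} (h₁0 : h₁ ≠ 0) (h₂0 : h₂ ≠ 0) :
    lam F G Ψ (h₁ * h₂) = lam F G Ψ h₁ * lam F G Ψ h₂ := by
  unfold lam
  rw [IsCoprime.mul_left_iff, aroots_mul (mul_ne_zero h₁0 h₂0), Multiset.map_add,
    Multiset.sum_add, AddChar.map_add_eq_mul]
  split_ifs <;> simp_all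

lemma aeval_ne_zero_of_isCoprime {h : (ZMod p)[X]} (hc : IsCoprime h G)
    {x : AlgebraicClosure (ZMod p)} (hx : aeval x h = 0) : aeval x G ≠ 0 := by
  obtain ⟨a, b, hab⟩ := hc
  intro h0
  have := congrArg (aeval x) hab
  simp [hx, h0] at this

variable {F G}

lemma lam_congr (hG : G.Monic) (hFG : F.degree < G.degree) {h h' : (ZMod p)[X]}
    (hh : h.Monic) (hh' : h'.Monic) (hd : G ^ 2 ∣ h - h') : lam F G Ψ h = lam F G Ψ h' := by
  obtain ⟨q, hq⟩ := hd
  have hq' : h = h' + G ^ 2 * q := by rw [← hq]; ring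
  have hc : IsCoprime h G ↔ IsCoprime h' G := by
    rw [hq', pow_two, mul_assoc]
    exact IsCoprime.add_mul_left_left_iff
  unfold lam
  rw [hc]
  split_ifs with h1
  · congr 1
    set ι := algebraMap (ZMod p) (AlgebraicClosure (ZMod p)) with hι
    have := sum_roots_congr (F.map ι) (G.map ι) (h.map ι) (h'.map ι) (q.map ι) (hG.map ι)
      (by rwa [degree_map, degree_map]) (hh.map ι) (hh'.map ι) (by rw [hq']; simp)
      (fun a ha => by
        rw [eval_map_algebraMap]
        refine aeval_ne_zero_of_isCoprime G (hc.2 h1) ?_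
        rw [mem_roots (hh.map ι).ne_zero, IsRoot, eval_map_algebraMap] at ha
        exact ha)
      (fun a ha => by
        rw [eval_map_algebraMap]
        refine aeval_ne_zero_of_isCoprime G h1 ?_
        rw [mem_roots (hh'.map ι).ne_zero, IsRoot, eval_map_algebraMap] at ha
        exact ha)
    simp only [hι, eval_map_algebraMap] at this
    exact this
  · rfl

lemma sum_lam_eq_zero (hG : G.Monic) (hFG : F.degree < G.degree) {h₀ : (ZMod p)[X]}
    (hh₀ : h₀.Monic) (hc : IsCoprime h₀ G) (h1 : lam F G Ψ h₀ ≠ 1) {n : ℕ}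
    (hn : 2 * G.natDegree ≤ n) : ∑ h ∈ monicPolys p n, lam F G Ψ h = 0 := by
  classical
  have hG2 : (G ^ 2).Monic := hG.pow 2
  have hG2d : (G ^ 2).natDegree = 2 * G.natDegree := by rw [hG.natDegree_pow]
  let τ : (ZMod p)[X] → (ZMod p)[X] := fun h => (h * h₀) %ₘ G ^ 2 + G ^ 2 * (h /ₘ G ^ 2)
  have hτd : ∀ h : (ZMod p)[X], G ^ 2 ∣ τ h - h * h₀ := by
    intro h
    refine ⟨h /ₘ G ^ 2 - (h * h₀) /ₘ G ^ 2, ?_⟩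
    have := modByMonic_add_div (h * h₀) (G ^ 2)
    simp only [τ]
    linear_combination this
  have hτm : ∀ h ∈ monicPolys p n, τ h ∈ monicPolys p n := by
    intro h hh
    rw [mem_monicPolys] at hh ⊢
    have e : h = h %ₘ G ^ 2 + G ^ 2 * (h /ₘ G ^ 2) := (modByMonic_add_div h _).symm
    have dle : (G ^ 2).degree ≤ h.degree := by
      rw [degree_eq_natDegree hG2.ne_zero, degree_eq_natDegree hh.1.ne_zero, hG2d, hh.2]
      exact_mod_cast hn
    have hqm : (h /ₘ G ^ 2).Monic := by
      rw [Monic, leadingCoeff_divByMonic_of_monic hG2 dle, hh.1.leadingCoeff]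
    have hqd : (G ^ 2 * (h /ₘ G ^ 2)).Monic := hG2.mul hqm
    have hqdeg : (G ^ 2 * (h /ₘ G ^ 2)).natDegree = n := by
      rw [hG2.natDegree_mul hqm, natDegree_divByMonic _ hG2, hG2d, hh.2]; omega
    have hlt : ((h * h₀) %ₘ G ^ 2).degree < (G ^ 2 * (h /ₘ G ^ 2)).degree := by
      refine (degree_modByMonic_lt _ hG2).trans_le ?_
      rw [degree_eq_natDegree hG2.ne_zero, degree_eq_natDegree hqd.ne_zero, hG2d, hqdeg]
      exact_mod_cast hn
    exact ⟨hqd.add_of_right hlt, by rw [natDegree_add_eq_right_of_degree_lt hlt, hqdeg]⟩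
  have hinj : Set.InjOn τ (monicPolys p n) := by
    intro h _ h' _ heq
    have hdiv : ∀ h : (ZMod p)[X], τ h /ₘ G ^ 2 = h /ₘ G ^ 2 := fun h =>
      (div_modByMonic_unique _ _ hG2 ⟨rfl, degree_modByMonic_lt _ hG2⟩).1
    have hq : h /ₘ G ^ 2 = h' /ₘ G ^ 2 := by rw [← hdiv h, ← hdiv h', heq]
    have hdvd : G ^ 2 ∣ (h - h') * h₀ := by
      have := dvd_sub (hτd h') (hτd h)
      rw [heq] at this
      convert this using 1; ring
    have hdvd2 : G ^ 2 ∣ h - h' := (hc.symm.pow_left).dvd_of_dvd_mul_right hdvd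
    have hr : h %ₘ G ^ 2 = h' %ₘ G ^ 2 := by
      have := (modByMonic_eq_zero_iff_dvd hG2).2 hdvd2
      rw [sub_modByMonic] at this
      exact sub_eq_zero.1 this
    rw [← modByMonic_add_div h (G ^ 2), ← modByMonic_add_div h' (G ^ 2), hq, hr]
  have himg : (monicPolys p n).image τ = monicPolys p n := by
    refine Finset.eq_of_subset_of_card_le ?_ ?_
    · exact Finset.image_subset_iff.2 hτm
    · rw [Finset.card_image_of_injOn hinj]
  have hsum : ∑ h ∈ monicPolys p n, lam F G Ψ h =
      (∑ h ∈ monicPolys p n, lam F G Ψ h) * lam F G Ψ h₀ := by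
    conv_lhs => rw [← himg, Finset.sum_image hinj]
    rw [Finset.sum_mul]
    refine Finset.sum_congr rfl fun h hh => ?_
    have hm := (mem_monicPolys p).1 hh
    have hm' := (mem_monicPolys p).1 (hτm h hh)
    rw [← lam_mul F G Ψ hm.1.ne_zero hh₀.ne_zero]
    exact lam_congr Ψ hG hFG hm'.1 (hm.1.mul hh₀) (hτd h)
  have : (∑ h ∈ monicPolys p n, lam F G Ψ h) * (1 - lam F G Ψ h₀) = 0 := by
    linear_combination hsum
  exact (mul_eq_zero.1 this).resolve_right (sub_ne_zero.2 (Ne.symm h1))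

end LFunction

section LFunction
variable {p : ℕ} [Fact p.Prime]
variable (F G : (ZMod p)[X]) (Ψ : AddChar (AlgebraicClosure (ZMod p)) ℂ)

lemma aeval_pow_prime_pow (g : (ZMod p)[X]) (x : AlgebraicClosure (ZMod p)) (i : ℕ) :
    aeval (x ^ p ^ i) g = aeval x g ^ p ^ i := by
  simp only [aeval_def, eval₂_eq_sum_range, ← iterateFrobenius_def, map_sum, map_mul, map_pow]
  simp only [iterateFrobenius_def, ← map_pow, ZMod.pow_card_pow]

lemma fracVal_pow (x : AlgebraicClosure (ZMod p)) (i : ℕ) :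
    fracVal F G (x ^ p ^ i) = fracVal F G x ^ p ^ i := by
  simp only [fracVal, aeval_pow_prime_pow, div_pow]

lemma sum_fracVal_pow (x : AlgebraicClosure (ZMod p)) (d e : ℕ) (hx : x ^ p ^ d = x) :
    ∑ i ∈ Finset.range (d * e), fracVal F G x ^ p ^ i =
      e • ∑ i ∈ Finset.range d, fracVal F G x ^ p ^ i := by
  have hv : fracVal F G x ^ p ^ d = fracVal F G x := by rw [← fracVal_pow, hx]
  have hv2 : ∀ e : ℕ, fracVal F G x ^ p ^ (d * e) = fracVal F G x := by
    intro e
    induction e with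
    | zero => simp
    | succ e ih => rw [Nat.mul_succ, pow_add, pow_mul, ih, hv]
  induction e with
  | zero => simp
  | succ e ih =>
    rw [Nat.mul_succ, Finset.sum_range_add, ih, succ_nsmul]
    congr 1
    refine Finset.sum_congr rfl fun i _ => ?_
    rw [pow_add, pow_mul, hv2]

open Classical in
lemma lam_minpoly_pow (x : AlgebraicClosure (ZMod p)) (e : ℕ) (he : e ≠ 0) :
    lam F G Ψ (minpoly (ZMod p) x ^ e) = if aeval x G ≠ 0 then
      Ψ (∑ i ∈ Finset.range ((minpoly (ZMod p) x).natDegree * e), fracVal F G x ^ p ^ i) else 0 := by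
  have hx : IsIntegral (ZMod p) x := Algebra.IsIntegral.isIntegral x
  have hc : IsCoprime (minpoly (ZMod p) x ^ e) G ↔ aeval x G ≠ 0 := by
    rw [IsCoprime.pow_left_iff (Nat.pos_of_ne_zero he),
      (minpoly.irreducible hx).coprime_iff_not_dvd, minpoly.dvd_iff]
  unfold lam
  simp only [hc]
  split_ifs with h
  · congr 1
    rw [sum_fracVal_pow _ _ _ _ _ ((pow_prime_pow_eq_self_iff p x _).2 dvd_rfl), aroots_pow,
      aroots_minpoly, Multiset.map_nsmul, Multiset.sum_nsmul, Multiset.map_map]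
    congr 1
    simp only [Function.comp_def, fracVal_pow]
    rfl
  · rfl

open Classical in
lemma sum_lam_mul (P : (ZMod p)[X]) (hP : P.Monic) (n : ℕ) :
    ∑ h ∈ monicPolys p n, lam F G Ψ P * lam F G Ψ h =
      ∑ h ∈ monicPolys p (P.natDegree + n) with P ∣ h, lam F G Ψ h := by
  refine Finset.sum_bij (fun h _ => P * h) ?_ ?_ ?_ ?_
  · intro h hh
    rw [mem_monicPolys] at hh
    rw [Finset.mem_filter, mem_monicPolys, hP.natDegree_mul hh.1, hh.2]
    exact ⟨⟨hP.mul hh.1, rfl⟩, dvd_mul_right _ _⟩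
  · intro a _ b _ hab
    exact mul_left_cancel₀ hP.ne_zero hab
  · intro h hh
    rw [Finset.mem_filter, mem_monicPolys] at hh
    obtain ⟨⟨h1, h2⟩, q, rfl⟩ := hh
    have hq : q.Monic := hP.of_mul_monic_left h1
    refine ⟨q, ?_, rfl⟩
    rw [hP.natDegree_mul hq] at h2
    rw [mem_monicPolys]
    exact ⟨hq, by omega⟩
  · intro h hh
    rw [mem_monicPolys] at hh
    rw [lam_mul F G Ψ hP.ne_zero hh.1.ne_zero]

/-- Newton's identities for the coefficients of the `L`-function. -/
lemma newton_lam (n : ℕ) :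
    (n + 1 : ℂ) * ∑ h ∈ monicPolys p (n + 1), lam F G Ψ h =
      ∑ j ∈ Finset.range (n + 1), expSum F G Ψ (j + 1) *
        ∑ h ∈ monicPolys p (n - j), lam F G Ψ h := by
  classical
  let R : (ZMod p)[X] → ℕ → AlgebraicClosure (ZMod p) → Prop := fun h j x =>
    x ^ p ^ (j + 1) = x ∧ minpoly (ZMod p) x ^ ((j + 1) / (minpoly (ZMod p) x).natDegree) ∣ h
  have step : ∀ j ∈ Finset.range (n + 1), expSum F G Ψ (j + 1) *
        ∑ h ∈ monicPolys p (n - j), lam F G Ψ h =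
      ∑ h ∈ monicPolys p (n + 1), lam F G Ψ h *
        ((h.aroots (AlgebraicClosure (ZMod p))).toFinset.filter (R h j)).card := by
    intro j hj
    have hj' : j ≤ n := by simpa [Nat.lt_succ_iff] using hj
    have e1 : ∀ x ∈ frobPoints p (j + 1), (if aeval x G ≠ 0 then
          Ψ (∑ i ∈ Finset.range (j + 1), fracVal F G x ^ p ^ i) else 0) *
        ∑ h ∈ monicPolys p (n - j), lam F G Ψ h =
        ∑ h ∈ monicPolys p (n + 1), if R h j x then lam F G Ψ h else 0 := by
      intro x hx
      rw [mem_frobPoints p j.add_one_ne_zero] at hx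
      have hxi : IsIntegral (ZMod p) x := Algebra.IsIntegral.isIntegral x
      obtain ⟨e, he⟩ := (pow_prime_pow_eq_self_iff p x _).1 hx
      have hd0 : 0 < (minpoly (ZMod p) x).natDegree := minpoly.natDegree_pos hxi
      have he0 : e ≠ 0 := by rintro rfl; omega
      have hm : (minpoly (ZMod p) x ^ e).Monic := (minpoly.monic hxi).pow e
      have hdeg : (minpoly (ZMod p) x ^ e).natDegree = j + 1 := by
        rw [natDegree_pow, he, mul_comm]
      have hdiv : (j + 1) / (minpoly (ZMod p) x).natDegree = e := by
        rw [he, Nat.mul_div_cancel_left _ hd0]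
      have h1 := lam_minpoly_pow F G Ψ x e he0
      rw [← he] at h1
      rw [← h1, Finset.mul_sum, sum_lam_mul F G Ψ _ hm, hdeg,
        show j + 1 + (n - j) = n + 1 by omega, Finset.sum_filter]
      refine Finset.sum_congr rfl fun h _ => ?_
      simp only [R, hx, hdiv, true_and]
    rw [expSum, Finset.sum_mul, Finset.sum_congr rfl e1, Finset.sum_comm]
    refine Finset.sum_congr rfl fun h hh => ?_
    rw [← Finset.sum_filter, Finset.sum_const, nsmul_eq_mul, mul_comm]
    congr 3
    ext x
    rw [Finset.mem_filter, Finset.mem_filter, mem_frobPoints p j.add_one_ne_zero,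
      Multiset.mem_toFinset, mem_aroots]
    have hm := (mem_monicPolys p).1 hh
    constructor
    · rintro ⟨h1, h2⟩
      refine ⟨⟨hm.1.ne_zero, ?_⟩, h2⟩
      have hxi : IsIntegral (ZMod p) x := Algebra.IsIntegral.isIntegral x
      have hd0 : 0 < (minpoly (ZMod p) x).natDegree := minpoly.natDegree_pos hxi
      have h3 := Nat.div_pos (Nat.le_of_dvd (Nat.succ_pos j)
        ((pow_prime_pow_eq_self_iff p x _).1 h1)) hd0
      rw [← minpoly.dvd_iff]
      exact (dvd_pow_self _ h3.ne').trans h2.2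
    · rintro ⟨-, h2⟩
      exact ⟨h2.1, h2⟩
  rw [Finset.sum_congr rfl step, Finset.sum_comm, Finset.mul_sum]
  refine Finset.sum_congr rfl fun h hh => ?_
  have hm := (mem_monicPolys p).1 hh
  rw [← Finset.mul_sum, mul_comm]
  congr 1
  rw [← Nat.cast_sum]
  have hcomm := Finset.sum_card_bipartiteAbove_eq_sum_card_bipartiteBelow
    (s := Finset.range (n + 1)) (t := (h.aroots (AlgebraicClosure (ZMod p))).toFinset) (R h)
  simp only [Finset.bipartiteAbove, Finset.bipartiteBelow] at hcomm
  rw [hcomm]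
  have hcount : ∀ x ∈ (h.aroots (AlgebraicClosure (ZMod p))).toFinset,
      ((Finset.range (n + 1)).filter fun j => R h j x).card =
        (h.aroots (AlgebraicClosure (ZMod p))).count x := by
    intro x _
    have := card_minpoly_pow_dvd p x h hm.1.ne_zero
    rw [hm.2] at this
    exact this
  rw [Finset.sum_congr rfl hcount, Multiset.toFinset_sum_count_eq, aroots,
    ← (IsAlgClosed.splits _).natDegree_eq_card_roots, hm.1.natDegree_map, hm.2]
  push_cast
  rfl

variable {F G}

lemma exists_lam_ne_one (hG : G ≠ 0) (B ρ : ℝ) (hρ : 0 < ρ) (hρp : ρ < p)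
    (hS : ∀ n, 1 ≤ n → ‖expSum F G Ψ n‖ ≤ B * ρ ^ n) :
    ∃ h : (ZMod p)[X], h.Monic ∧ IsCoprime h G ∧ lam F G Ψ h ≠ 1 := by
  classical
  by_contra! hcon
  have hp1 : (1 : ℝ) < p := by exact_mod_cast (Fact.out : p.Prime).one_lt
  have hval : ∀ n, 1 ≤ n → (p : ℝ) ^ n - G.natDegree ≤ B * ρ ^ n := by
    intro n hn
    have hn0 : n ≠ 0 := by omega
    have h1 : expSum F G Ψ n = (((frobPoints p n).filter fun x => aeval x G ≠ 0).card : ℂ) := by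
      rw [expSum, Finset.card_filter]
      push_cast
      refine Finset.sum_congr rfl fun x hx => ?_
      rw [mem_frobPoints p hn0] at hx
      have hxi : IsIntegral (ZMod p) x := Algebra.IsIntegral.isIntegral x
      obtain ⟨e, he⟩ := (pow_prime_pow_eq_self_iff p x _).1 hx
      have he0 : e ≠ 0 := by rintro rfl; omega
      have h2 := lam_minpoly_pow F G Ψ x e he0
      rw [← he] at h2
      by_cases hx0 : aeval x G = 0
      · simp [hx0]
      · rw [← h2, if_pos hx0]
        refine hcon _ ((minpoly.monic hxi).pow e) ?_
        rw [IsCoprime.pow_left_iff (Nat.pos_of_ne_zero he0),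
          (minpoly.irreducible hxi).coprime_iff_not_dvd, minpoly.dvd_iff]
        exact hx0
    have h2 := hS n hn
    rw [h1, Complex.norm_natCast] at h2
    refine le_trans ?_ h2
    have h3 := Finset.card_filter_add_card_filter_not (s := frobPoints p n) (fun x => aeval x G ≠ 0)
    have h4 : ((frobPoints p n).filter fun x => ¬ aeval x G ≠ 0).card ≤ G.natDegree := by
      calc _ ≤ (G.aroots (AlgebraicClosure (ZMod p))).toFinset.card := by
            refine Finset.card_le_card fun x hx => ?_
            rw [Finset.mem_filter] at hx
            rw [Multiset.mem_toFinset, mem_aroots]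
            exact ⟨hG, not_not.1 hx.2⟩
        _ ≤ (G.aroots (AlgebraicClosure (ZMod p))).card := Multiset.toFinset_card_le _
        _ ≤ _ := (card_roots' _).trans natDegree_map_le
    rw [card_frobPoints p hn0] at h3
    have h5 : (p : ℝ) ^ n ≤ (((frobPoints p n).filter fun x => aeval x G ≠ 0).card : ℝ) +
        G.natDegree := by
      exact_mod_cast (by omega : p ^ n ≤ ((frobPoints p n).filter fun x => aeval x G ≠ 0).card +
        G.natDegree)
    linarith
  have t1 : Filter.Tendsto (fun n : ℕ => B * (ρ / p) ^ n + G.natDegree * ((p : ℝ)⁻¹) ^ n)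
      Filter.atTop (nhds (B * 0 + G.natDegree * 0)) :=
    ((tendsto_pow_atTop_nhds_zero_of_lt_one (by positivity)
      ((div_lt_one (by positivity)).2 hρp)).const_mul _).add
      ((tendsto_pow_atTop_nhds_zero_of_lt_one (by positivity) (inv_lt_one_of_one_lt₀ hp1)).const_mul _)
  have t2 : (1 : ℝ) ≤ B * 0 + G.natDegree * 0 := by
    refine ge_of_tendsto t1 ?_
    filter_upwards [Filter.eventually_ge_atTop 1] with n hn
    have h1 := hval n hn
    have hpn : (0 : ℝ) < (p : ℝ) ^ n := by positivity
    rw [div_pow, inv_pow]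
    have : B * (ρ ^ n / (p : ℝ) ^ n) + G.natDegree * ((p : ℝ) ^ n)⁻¹ =
      (B * ρ ^ n + G.natDegree) / (p : ℝ) ^ n := by field_simp
    rw [this, le_div_iff₀ hpn]
    linarith
  norm_num at t2

/-- A bound of square-root quality over all extensions, with an unspecified constant, implies the
bound with constant `2 deg G` over the prime field. -/
lemma norm_expSum_one_le (hG : G.Monic) (hG1 : 1 ≤ G.natDegree) (hFG : F.degree < G.degree)
    (B ρ : ℝ) (hρ : 0 < ρ) (hρp : ρ < p)
    (hS : ∀ n, 1 ≤ n → ‖expSum F G Ψ n‖ ≤ B * ρ ^ n) :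
    ‖expSum F G Ψ 1‖ ≤ 2 * G.natDegree * ρ := by
  obtain ⟨h₀, hm, hc, h1⟩ := exists_lam_ne_one Ψ hG.ne_zero B ρ hρ hρp hS
  have := norm_le_of_newton (fun n => ∑ h ∈ monicPolys p n, lam F G Ψ h) (expSum F G Ψ)
    (2 * G.natDegree) B ρ hρ ?_ ?_ (by omega) hS (newton_lam F G Ψ)
  · exact_mod_cast this
  · have : monicPolys p 0 = {1} := by
      ext h
      rw [mem_monicPolys, Finset.mem_singleton]
      constructor
      · rintro ⟨h1, h2⟩; exact h1.natDegree_eq_zero.1 h2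
      · rintro rfl; exact ⟨monic_one, natDegree_one⟩
    simp [this, lam_one]
  · intro n hn
    exact sum_lam_eq_zero Ψ hG hFG hm hc h1 hn.le

end LFunction

section ArtinSchreier
variable {K : Type} [Field K]

/-- The equation satisfied by `Z = G Y` when `Y ^ p - Y = F / G`. -/
def asPoly (p : ℕ) (F G : K[X]) : K[X][X] :=
  X ^ p - (C (G ^ (p - 1)) * X + C (G ^ (p - 1) * F))

lemma degree_asPoly_tail (p : ℕ) (hp : 1 < p) (F G : K[X]) :
    (C (G ^ (p - 1)) * X + C (G ^ (p - 1) * F) : K[X][X]).degree < (p : WithBot ℕ) :=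
  degree_linear_le.trans_lt (by exact_mod_cast hp)

lemma monic_asPoly (p : ℕ) (hp : 1 < p) (F G : K[X]) : (asPoly p F G).Monic :=
  monic_X_pow_sub (degree_asPoly_tail p hp F G)

lemma natDegree_asPoly (p : ℕ) (hp : 1 < p) (F G : K[X]) : (asPoly p F G).natDegree = p := by
  rw [asPoly, natDegree_sub_eq_left_of_natDegree_lt]
  · exact natDegree_X_pow p
  · rw [natDegree_X_pow]
    exact natDegree_linear_le.trans_lt hp

/-- A place of the Artin-Schreier extension above a pole of `F / G`. -/
lemma exists_valuation (p : ℕ) (hp : 1 < p) (F G G₁ : K[X]) (β : K) (d : ℕ) (hd : 0 < d)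
    (hG : G = (X - C β) ^ d * G₁) (hG₁ : G₁.eval β ≠ 0) (hF : F.eval β ≠ 0) :
    ∃ (E : Type) (_ : Field E) (ev : K[X][X] →+* E) (Γ : Type)
      (_ : LinearOrderedCommGroupWithZero Γ) (v : Valuation E Γ) (τ : Γ),
      ev (asPoly p F G) = 0 ∧ (∀ c : K, c ≠ 0 → v (ev (C (C c))) = 1) ∧
      v (ev (C (X - C β))) = τ ∧ τ ≠ 0 ∧ τ < 1 ∧ v (ev X) ^ p = τ ^ ((p - 1) * d) := by
  set E := AlgebraicClosure (RatFunc K)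
  let ι : K[X] →+* E := algebraMap K[X] E
  have hι : Function.Injective ι := by
    have : ι = (algebraMap (RatFunc K) E).comp (algebraMap K[X] (RatFunc K)) :=
      IsScalarTower.algebraMap_eq _ _ _
    rw [this]
    exact (algebraMap (RatFunc K) E).injective.comp (RatFunc.algebraMap_injective K)
  have hG0 : G ≠ 0 := by
    rw [hG]
    refine mul_ne_zero (pow_ne_zero _ (X_sub_C_ne_zero β)) ?_
    rintro rfl; simp at hG₁
  have hιG : ι G ≠ 0 := (map_ne_zero_iff ι hι).2 hG0
  obtain ⟨y, hy⟩ : ∃ y : E, y ^ p - y = ι F / ι G := by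
    have hdeg : (X ^ p - (X + C (ι F / ι G)) : E[X]).degree ≠ 0 := by
      have h1 : (X + C (ι F / ι G) : E[X]).natDegree < (X ^ p : E[X]).natDegree := by
        rw [natDegree_X_pow, natDegree_X_add_C]; exact hp
      have h2 : (X ^ p - (X + C (ι F / ι G)) : E[X]).natDegree = p := by
        rw [natDegree_sub_eq_left_of_natDegree_lt h1, natDegree_X_pow]
      intro h
      have := natDegree_eq_zero_iff_degree_le_zero.2 h.le
      omega
    obtain ⟨y, hy⟩ := IsAlgClosed.exists_root _ hdeg
    refine ⟨y, ?_⟩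
    simp at hy
    linear_combination hy
  let ev : K[X][X] →+* E := eval₂RingHom ι (ι G * y)
  have evC : ∀ f, ev (C f) = ι f := fun f => eval₂_C _ _
  have evX : ev X = ι G * y := eval₂_X _ _
  let A : Subring E := ι.range
  let ι' : K[X] →+* A := ι.rangeRestrict
  have hbij : Function.Bijective ι' :=
    ⟨fun a b h => hι (congrArg Subtype.val h), ι.rangeRestrict_surjective⟩
  let I : Ideal A := Ideal.span {ι' (X - C β)}
  have hI : I ≠ ⊤ := by
    rw [Ne, Ideal.span_singleton_eq_top]
    intro hu
    have := (isUnit_map_iff (RingEquiv.ofBijective ι' hbij) (X - C β)).1 hu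
    exact not_isUnit_X_sub_C β this
  obtain ⟨B, hAB, hIB⟩ := Ideal.image_subset_nonunits_valuationSubring I hI
  set v := B.valuation
  have hle : ∀ f : K[X], v (ι f) ≤ 1 := fun f =>
    (B.valuation_le_one_iff _).2 (hAB ⟨f, rfl⟩)
  have hconst : ∀ c : K, c ≠ 0 → v (ι (C c)) = 1 := by
    intro c hc
    refine le_antisymm (hle _) ?_
    have h1 : v (ι (C c)) * v (ι (C c⁻¹)) = 1 := by
      rw [← map_mul, ← map_mul, ← C_mul, mul_inv_cancel₀ hc]; simp
    calc (1 : B.ValueGroup) = v (ι (C c)) * v (ι (C c⁻¹)) := h1.symm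
      _ ≤ v (ι (C c)) * 1 := by gcongr; exact hle _
      _ = _ := mul_one _
  have hτ1 : v (ι (X - C β)) < 1 := by
    have : ι (X - C β) ∈ B.nonunits := hIB ⟨ι' (X - C β), Ideal.mem_span_singleton_self _, rfl⟩
    exact (B.mem_nonunits_iff).1 this
  have hτ0 : v (ι (X - C β)) ≠ 0 :=
    (Valuation.ne_zero_iff _).2 ((map_ne_zero_iff ι hι).2 (X_sub_C_ne_zero β))
  have hunit : ∀ f : K[X], f.eval β ≠ 0 → v (ι f) = 1 := by
    intro f hf
    obtain ⟨g, hg⟩ := X_sub_C_dvd_sub_C_eval (a := β) (p := f)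
    have h1 : ι f = ι ((X - C β) * g) + ι (C (f.eval β)) := by
      rw [← map_add, ← hg]; congr 1; ring
    rw [h1, Valuation.map_add_eq_of_lt_right, hconst _ hf]
    rw [hconst _ hf, map_mul, map_mul]
    calc v (ι (X - C β)) * v (ι g) ≤ v (ι (X - C β)) * 1 := by gcongr; exact hle _
      _ < 1 := by rwa [mul_one]
  set τ := v (ι (X - C β))
  have hvG : v (ι G) = τ ^ d := by
    rw [hG, map_mul, map_mul, hunit G₁ hG₁, mul_one, map_pow, map_pow]
  have hvφ : v (y ^ p - y) = (τ ^ d)⁻¹ := by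
    rw [hy, map_div₀, hvG, hunit F hF, one_div]
  have hbig : 1 < (τ ^ d)⁻¹ :=
    (one_lt_inv₀ (zero_lt_iff.2 (pow_ne_zero _ hτ0))).2 (pow_lt_one₀ zero_le hτ1 hd.ne')
  have hy1 : 1 < v y := by
    by_contra! hcon
    have : v (y ^ p - y) ≤ 1 := by
      refine (Valuation.map_sub _ _ _).trans (max_le ?_ hcon)
      rw [map_pow]; exact pow_le_one₀ zero_le hcon
    rw [hvφ] at this
    exact absurd hbig (not_lt.2 this)
  have hyp : v y ^ p = (τ ^ d)⁻¹ := by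
    rw [← hvφ, Valuation.map_sub_eq_of_lt_left, map_pow]
    rw [map_pow]
    exact lt_self_pow₀ hy1 hp
  refine ⟨E, inferInstance, ev, B.ValueGroup, inferInstance, v, τ, ?_, ?_, ?_, hτ0, hτ1, ?_⟩
  · simp only [asPoly, map_sub, map_add, map_mul, evC, evX, map_pow]
    have e : ι G ^ p = ι G ^ (p - 1) * ι G := by rw [← pow_succ, Nat.sub_add_cancel hp.le]
    have hy' : ι G * (y ^ p - y) = ι F := by rw [hy, mul_div_cancel₀ _ hιG]
    rw [mul_pow, e]
    linear_combination (ι G) ^ (p - 1) * hy'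
  · intro c hc; rw [evC]; exact hconst c hc
  · rw [evC]
  · rw [evX, map_mul, mul_pow, hyp, hvG, ← pow_mul]
    have e : d * p = (p - 1) * d + d := by
      rw [← Nat.succ_mul, Nat.succ_eq_add_one, Nat.sub_add_cancel hp.le, mul_comm]
    rw [e, pow_add, mul_assoc, mul_inv_cancel₀ (pow_ne_zero _ hτ0), mul_one]

end ArtinSchreier

section WeightedDegree
variable {K : Type} [Field K]

/-- `P` has weighted degree at most `t`, where the inner variable has weight one and the outer
variable has weight `w`. -/
def WDegLE (w t : ℕ) (P : K[X][X]) : Prop :=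
  ∀ j, P.coeff j ≠ 0 → (P.coeff j).natDegree + w * j ≤ t

variable {w t t' : ℕ} {P P' : K[X][X]}

lemma WDegLE.mono (h : WDegLE w t P) (ht : t ≤ t') : WDegLE w t' P :=
  fun j hj => (h j hj).trans ht

lemma WDegLE.add (h : WDegLE w t P) (h' : WDegLE w t P') : WDegLE w t (P + P') := by
  intro j hj
  rw [coeff_add] at hj ⊢
  by_cases h0 : P.coeff j = 0
  · rw [h0, zero_add] at hj ⊢; exact h' j hj
  by_cases h0' : P'.coeff j = 0
  · rw [h0', add_zero] at hj ⊢; exact h j hj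
  have h1 := h j h0
  have h2 := h' j h0'
  have h3 := natDegree_add_le (P.coeff j) (P'.coeff j)
  omega

lemma WDegLE.neg (h : WDegLE w t P) : WDegLE w t (-P) := by
  intro j hj
  rw [coeff_neg] at hj ⊢
  rw [natDegree_neg]
  exact h j (neg_ne_zero.1 hj)

lemma WDegLE.sub (h : WDegLE w t P) (h' : WDegLE w t P') : WDegLE w t (P - P') := by
  rw [sub_eq_add_neg]; exact h.add h'.neg

lemma wDegLE_zero : WDegLE w t (0 : K[X][X]) := fun j hj => absurd (coeff_zero j) hj

lemma wDegLE_sum {ι : Type} (s : Finset ι) (f : ι → K[X][X]) (h : ∀ i ∈ s, WDegLE w t (f i)) :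
    WDegLE w t (∑ i ∈ s, f i) := by
  classical
  induction s using Finset.induction_on with
  | empty => simpa using wDegLE_zero
  | insert a s ha ih =>
    rw [Finset.sum_insert ha]
    exact (h a (Finset.mem_insert_self a s)).add
      (ih fun i hi => h i (Finset.mem_insert_of_mem hi))

lemma wDegLE_C {f : K[X]} (hf : f.natDegree ≤ t) : WDegLE w t (C f : K[X][X]) := by
  intro j hj
  rw [coeff_C] at hj ⊢
  split_ifs at hj ⊢ with h
  · subst h; simpa using hf
  · exact absurd rfl hj

lemma WDegLE.mul (h : WDegLE w t P) (h' : WDegLE w t' P') : WDegLE w (t + t') (P * P') := by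
  intro j hj
  rw [coeff_mul] at hj ⊢
  have key : ∀ x ∈ Finset.HasAntidiagonal.antidiagonal j,
      (P.coeff x.1 * P'.coeff x.2).natDegree ≤ t + t' - w * j ∧
        (P.coeff x.1 * P'.coeff x.2 ≠ 0 → w * j ≤ t + t') := by
    intro x hx
    rw [Finset.HasAntidiagonal.mem_antidiagonal] at hx
    have hw : w * j = w * x.1 + w * x.2 := by rw [← hx, mul_add]
    by_cases h0 : P.coeff x.1 * P'.coeff x.2 = 0
    · simp [h0]
    have h1 := h x.1 (left_ne_zero_of_mul h0)
    have h2 := h' x.2 (right_ne_zero_of_mul h0)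
    have h3 := natDegree_mul_le (p := P.coeff x.1) (q := P'.coeff x.2)
    refine ⟨?_, fun _ => ?_⟩ <;> omega
  have h4 : (∑ x ∈ Finset.HasAntidiagonal.antidiagonal j, P.coeff x.1 * P'.coeff x.2).natDegree
      ≤ t + t' - w * j :=
    natDegree_sum_le_of_forall_le _ _ fun x hx => (key x hx).1
  obtain ⟨x, hx, hx0⟩ := Finset.exists_ne_zero_of_sum_ne_zero hj
  have := (key x hx).2 hx0
  omega

lemma wDegLE_X : WDegLE w w (X : K[X][X]) := by
  intro j hj
  rw [coeff_X] at hj ⊢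
  split_ifs at hj ⊢ with h
  · subst h; simp
  · exact absurd rfl hj

lemma WDegLE.pow (h : WDegLE w t P) (m : ℕ) : WDegLE w (m * t) (P ^ m) := by
  induction m with
  | zero =>
    rw [pow_zero, zero_mul, ← C_1]
    exact wDegLE_C (by simp)
  | succ m ih =>
    rw [pow_succ, Nat.succ_mul]; exact ih.mul h

lemma wDegLE_asPoly (p : ℕ) (hp : 1 < p) {F G : K[X]} (hF : F.natDegree ≤ G.natDegree) :
    WDegLE G.natDegree (p * G.natDegree) (asPoly p F G) := by
  have e : p * G.natDegree = (p - 1) * G.natDegree + G.natDegree := by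
    conv_lhs => rw [← Nat.sub_add_cancel hp.le, Nat.add_mul, one_mul]
  have hGp : (G ^ (p - 1)).natDegree ≤ (p - 1) * G.natDegree := natDegree_pow_le
  refine (wDegLE_X.pow p).sub (WDegLE.add ?_ ?_)
  · rw [e]; exact (wDegLE_C hGp).mul wDegLE_X
  · refine wDegLE_C (natDegree_mul_le.trans ?_)
    omega

lemma wDegLE_modByMonic {Φ : K[X][X]} (hΦ : Φ.Monic) (hw : WDegLE w (Φ.natDegree * w) Φ)
    (h : WDegLE w t P) : WDegLE w t (P %ₘ Φ) := by
  induction hd : P.degree using WellFoundedLT.induction generalizing P with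
  | ind d ih =>
    by_cases hlt : P.degree < Φ.degree
    · rwa [(modByMonic_eq_self_iff hΦ).2 hlt]
    have hle := not_lt.1 hlt
    have hP0 : P ≠ 0 := by
      rintro rfl
      rw [degree_zero, le_bot_iff, degree_eq_bot] at hle
      exact hΦ.ne_zero hle
    have hlt' := div_wf_lemma ⟨hle, hP0⟩ hΦ
    have hnat := natDegree_le_natDegree hle
    have hlead := h P.natDegree (by simpa using hP0)
    have hsub : WDegLE w t
        (P - Φ * (C P.leadingCoeff * X ^ (P.natDegree - Φ.natDegree))) := by
      refine h.sub ((hw.mul ((wDegLE_C le_rfl).mul (wDegLE_X.pow _))).mono ?_)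
      have e : w * P.natDegree
          = Φ.natDegree * w + (P.natDegree - Φ.natDegree) * w := by
        rw [← add_mul, Nat.add_sub_cancel' hnat, mul_comm]
      rw [coeff_natDegree] at hlead
      omega
    have := ih _ (hd ▸ hlt') hsub rfl
    rwa [sub_modByMonic, (modByMonic_eq_zero_iff_dvd hΦ).2 (dvd_mul_right _ _), sub_zero] at this

lemma exists_relation_mod {ι : Type} [Fintype ι] {Φ : K[X][X]} (hΦ : Φ.Monic)
    (hw : WDegLE w (Φ.natDegree * w) Φ) (D : ι → K[X][X]) (hD : ∀ k, WDegLE w t (D k))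
    (hcard : Φ.natDegree * (t + 1) < Fintype.card ι) :
    ∃ γ : ι → K, (∃ k, γ k ≠ 0) ∧ Φ ∣ ∑ k, C (C (γ k)) * D k := by
  let u : ι → (Fin Φ.natDegree × Fin (t + 1) → K) := fun k x =>
    ((D k %ₘ Φ).coeff x.1).coeff x.2
  have hnot : ¬ LinearIndependent K u := by
    intro hli
    have := hli.fintype_card_le_finrank
    simp at this
    omega
  obtain ⟨γ, hγ, hγ0⟩ := Fintype.not_linearIndependent_iff.1 hnot
  refine ⟨γ, hγ0, ?_⟩
  have hzero : ∑ k, C (C (γ k)) * (D k %ₘ Φ) = 0 := by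
    ext j l
    rw [finsetSum_coeff, finsetSum_coeff, coeff_zero, coeff_zero]
    simp only [coeff_C_mul]
    by_cases hj : j < Φ.natDegree
    · by_cases hl : l < t + 1
      · have := congrFun hγ (⟨j, hj⟩, ⟨l, hl⟩)
        simpa [u, Finset.sum_apply] using this
      · refine Finset.sum_eq_zero fun k _ => ?_
        by_cases h0 : (D k %ₘ Φ).coeff j = 0
        · simp [h0]
        have := wDegLE_modByMonic hΦ hw (hD k) j h0
        rw [coeff_eq_zero_of_natDegree_lt (by omega), mul_zero]
    · refine Finset.sum_eq_zero fun k _ => ?_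
      have : (D k %ₘ Φ).coeff j = 0 := by
        refine coeff_eq_zero_of_degree_lt ((degree_modByMonic_lt _ hΦ).trans_le ?_)
        rw [degree_eq_natDegree hΦ.ne_zero]
        exact_mod_cast not_lt.1 hj
      simp [this]
  have : ∑ k, C (C (γ k)) * D k = ∑ k, C (C (γ k)) * (Φ * (D k /ₘ Φ)) := by
    rw [← sub_eq_zero, ← Finset.sum_sub_distrib, ← hzero]
    refine Finset.sum_congr rfl fun k _ => ?_
    conv_lhs => rw [← mul_sub]
    congr 1
    linear_combination - (modByMonic_add_div (D k) Φ)
  rw [this]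
  exact Finset.dvd_sum fun k _ => ⟨C (C (γ k)) * (D k /ₘ Φ), by ring⟩

end WeightedDegree

section Nonvanishing
variable {K : Type} [Field K]

lemma not_asPoly_dvd_sum {ι : Type} [Fintype ι] (p : ℕ) (hp : 1 < p) (F G G₁ : K[X]) (β : K)
    (d : ℕ) (hd : 0 < d) (hG : G = (X - C β) ^ d * G₁) (hG₁ : G₁.eval β ≠ 0)
    (hF : F.eval β ≠ 0) (a b : ι → ℕ)
    (hinj : Function.Injective fun k => p * a k + (p - 1) * d * b k) (γ : ι → K)
    (hγ : ∃ k, γ k ≠ 0) :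
    ¬ asPoly p F G ∣ ∑ k, C (C (γ k)) * (C ((X - C β) ^ a k) * X ^ b k) := by
  classical
  rintro ⟨q, hq⟩
  obtain ⟨E, _, ev, Γ, _, v, τ, hev, hc, hπ, hτ0, hτ1, hX⟩ :=
    exists_valuation p hp F G G₁ β d hd hG hG₁ hF
  let N : ι → ℕ := fun k => p * a k + (p - 1) * d * b k
  let T : ι → E := fun k => ev (C (C (γ k)) * (C ((X - C β) ^ a k) * X ^ b k))
  have hsum : ∑ k, T k = 0 := by
    simp only [T]
    rw [← map_sum, hq, map_mul, hev, zero_mul]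
  have hT : ∀ k, γ k ≠ 0 → v (T k) ^ p = τ ^ N k := by
    intro k hk
    simp only [T, N]
    rw [map_mul, map_mul, hc _ hk, one_mul, map_mul, map_mul, C_pow, map_pow, map_pow, hπ,
      map_pow, map_pow, mul_pow, ← pow_mul, ← pow_mul, pow_add, mul_comm (b k) p,
      pow_mul (v (ev X)), hX, ← pow_mul, mul_comm (a k)]
  obtain ⟨k₀, hk₀, hmin⟩ := Finset.exists_min_image (Finset.univ.filter fun k => γ k ≠ 0) N
    (by obtain ⟨k, hk⟩ := hγ; exact ⟨k, by simpa using hk⟩)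
  have hk₀' : γ k₀ ≠ 0 := by simpa using hk₀
  have hTk₀ : v (T k₀) ≠ 0 := by
    intro h0
    have := hT k₀ hk₀'
    rw [h0, zero_pow (by omega)] at this
    exact pow_ne_zero _ hτ0 this.symm
  have hlt : ∀ k ∈ Finset.univ.erase k₀, v (T k) < v (T k₀) := by
    intro k hk
    have hne := Finset.ne_of_mem_erase hk
    by_cases h0 : γ k = 0
    · have : T k = 0 := by simp [T, h0]
      rw [this, map_zero]
      exact zero_lt_iff.2 hTk₀
    have hN : N k₀ < N k :=
      lt_of_le_of_ne (hmin k (by simpa using h0)) fun h => hne (hinj h.symm)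
    refine lt_of_pow_lt_pow_left₀ p zero_le ?_
    rw [hT k h0, hT k₀ hk₀']
    exact pow_lt_pow_right_of_lt_one₀ (zero_lt_iff.2 hτ0) hτ1 hN
  have h1 := v.map_sum_lt hTk₀ hlt
  rw [← Finset.add_sum_erase _ _ (Finset.mem_univ k₀)] at hsum
  have h2 := Valuation.map_add_eq_of_lt_left v h1
  rw [hsum, map_zero] at h2
  exact hTk₀ h2.symm

end Nonvanishing

section Stepanov
variable {K : Type} [Field K]

/-- Evaluation of a bivariate polynomial at a point. -/
def evalTwo (x z : K) : K[X][X] →+* K := eval₂RingHom (evalRingHom x) z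

@[simp] lemma evalTwo_C (x z : K) (f : K[X]) : evalTwo x z (C f) = f.eval x := eval₂_C _ _

@[simp] lemma evalTwo_X (x z : K) : evalTwo x z X = z := eval₂_X _ _

lemma evalTwo_eq (x z : K) (P : K[X][X]) : evalTwo x z P = (P.map (evalRingHom x)).eval z :=
  (eval_map _ _).symm

lemma evalTwo_asPoly {p : ℕ} (hp : 1 < p) {F G : K[X]} {x y : K} (hx : G.eval x ≠ 0)
    (hy : y ^ p - y = F.eval x / G.eval x) : evalTwo x (G.eval x * y) (asPoly p F G) = 0 := by
  simp only [asPoly, map_sub, map_add, map_mul, evalTwo_C, evalTwo_X, map_pow]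
  have e : (G.eval x) ^ p = G.eval x ^ (p - 1) * G.eval x := by
    rw [← pow_succ, Nat.sub_add_cancel hp.le]
  have hFy : G.eval x * (y ^ p - y) = F.eval x := by rw [hy, mul_div_cancel₀ _ hx]
  rw [mul_pow, e]
  linear_combination (G.eval x) ^ (p - 1) * hFy

/-- If a bivariate polynomial vanishes at all conjugate points above each `x ∈ S`, then either
`S` is small or the polynomial is divisible by the Artin-Schreier equation. -/
lemma card_le_of_vanishing {p : ℕ} [Fact p.Prime] [CharP K p] {F G : K[X]}
    (hFG : F.natDegree ≤ G.natDegree) {T : ℕ} {g : K[X][X]} (hg : WDegLE G.natDegree T g)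
    (hdvd : ¬ asPoly p F G ∣ g) (S : Finset K) (y : K → K)
    (hS : ∀ x ∈ S, G.eval x ≠ 0 ∧ y x ^ p - y x = F.eval x / G.eval x)
    (hvan : ∀ x ∈ S, ∀ k : ℕ, evalTwo x (G.eval x * (y x + k)) g = 0) : S.card ≤ T := by
  classical
  have hp := (Fact.out : p.Prime).one_lt
  have hΦ := monic_asPoly p hp F G
  have hdeg := natDegree_asPoly p hp F G
  set r := g %ₘ asPoly p F G with hr
  have hr0 : r ≠ 0 := fun h => hdvd ((modByMonic_eq_zero_iff_dvd hΦ).1 h)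
  have hrw : WDegLE G.natDegree T r := by
    refine wDegLE_modByMonic hΦ ?_ hg
    rw [hdeg]; exact wDegLE_asPoly p hp hFG
  have hrdeg : r.natDegree < p := by
    have := natDegree_modByMonic_lt g hΦ (by
      intro h; rw [h, natDegree_one] at hdeg; omega)
    rwa [hdeg] at this
  obtain ⟨j, hj⟩ : ∃ j, r.coeff j ≠ 0 := by
    by_contra! h
    exact hr0 (ext h)
  have hvanr : ∀ x ∈ S, r.map (evalRingHom x) = 0 := by
    intro x hx
    obtain ⟨hGx, hyx⟩ := hS x hx
    refine eq_zero_of_natDegree_lt_card_of_eval_eq_zero (r.map (evalRingHom x))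
      (f := fun k : Fin p => G.eval x * (y x + ((k : ℕ) : K))) ?_ ?_ ?_
    · intro k k' hkk
      have h1 := add_left_cancel (mul_left_cancel₀ hGx hkk)
      have h2 := (CharP.natCast_eq_natCast K p).1 h1
      exact Fin.ext (Nat.ModEq.eq_of_lt_of_lt h2 k.2 k'.2)
    · intro k
      rw [← evalTwo_eq]
      have h1 := hvan x hx k
      rw [← modByMonic_add_div g (asPoly p F G), map_add, map_mul, evalTwo_asPoly hp hGx,
        zero_mul, add_zero] at h1
      · exact h1
      · rw [add_pow_char, ← hyx]
        have : ((k : ℕ) : K) ^ p = (k : ℕ) := by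
          have := map_natCast (frobenius K p) k
          rwa [frobenius_def] at this
        rw [this]; ring
    · rw [Fintype.card_fin]
      exact natDegree_map_le.trans_lt hrdeg
  have hroots : ∀ x ∈ S, (r.coeff j).IsRoot x := by
    intro x hx
    have := congrArg (fun P => coeff P j) (hvanr x hx)
    simpa [coeff_map] using this
  calc S.card ≤ (r.coeff j).roots.toFinset.card := by
        refine Finset.card_le_card fun x hx => ?_
        rw [Multiset.mem_toFinset, mem_roots hj]
        exact hroots x hx
    _ ≤ Multiset.card (r.coeff j).roots := Multiset.toFinset_card_le _
    _ ≤ (r.coeff j).natDegree := card_roots' _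
    _ ≤ T := by have := hrw j hj; omega

end Stepanov

section StepanovBound
variable {K : Type} [Field K]

lemma eq_of_linear_eq {p e i i' j j' : ℕ} (he : e.Coprime p) (hj : j < p) (hj' : j' < p)
    (h : p * i + e * j = p * i' + e * j') : i = i' ∧ j = j' := by
  have h1 : e * j ≡ e * j' [MOD p] := by
    have := congrArg (· % p) h
    simpa [Nat.ModEq, Nat.mul_add_mod] using this
  have h2 : j = j' := (Nat.ModEq.cancel_left_of_coprime he.symm h1).eq_of_lt_of_lt hj hj'
  subst h2
  exact ⟨Nat.eq_of_mul_eq_mul_left (by omega) (Nat.add_right_cancel h), rfl⟩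

lemma eq_of_block_eq {R u u' v v' : ℕ} (hu : u < R) (hu' : u' < R)
    (h : u + R * v = u' + R * v') : u = u' ∧ v = v' := by
  have h1 := congrArg (· % R) h
  simp only [Nat.add_mul_mod_self_left, Nat.mod_eq_of_lt hu, Nat.mod_eq_of_lt hu'] at h1
  subst h1
  exact ⟨rfl, Nat.eq_of_mul_eq_mul_left (by omega) (Nat.add_left_cancel h)⟩

lemma stepanov_exponent_injective {p d r J : ℕ} (hp : p.Prime) (hd : 0 < d) (hdp : d < p) :
    Function.Injective fun k : (Fin p × Fin p) × (Fin (r - (p - 1) * d) × Fin J) =>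
      p * ((k.2.1 : ℕ) + p * r * k.2.2) + (p - 1) * d * ((k.1.1 : ℕ) + p * r * k.1.2) := by
  set e := (p - 1) * d with he
  have hcop : e.Coprime p := by
    refine Nat.Coprime.mul_left ?_ ?_
    · exact (Nat.coprime_of_lt_prime (by have := hp.two_le; omega) (by have := hp.two_le; omega) hp).symm
    · exact (Nat.coprime_of_lt_prime hd.ne' hdp hp).symm
  have hsmall : ∀ (i : Fin (r - e)) (j : Fin p), p * (i : ℕ) + e * j < p * r := by
    intro i j
    have h1 := i.2
    have h2 : p * ((i : ℕ) + e) < p * r := Nat.mul_lt_mul_of_pos_left (by omega) hp.pos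
    have h3 : e * (j : ℕ) ≤ e * p := Nat.mul_le_mul_left _ j.2.le
    nlinarith
  rintro ⟨⟨j, j'⟩, ⟨i, i'⟩⟩ ⟨⟨l, l'⟩, ⟨k, k'⟩⟩ h
  simp only at h
  have h' : (p * (i : ℕ) + e * j) + p * r * (p * i' + e * j')
      = (p * (k : ℕ) + e * l) + p * r * (p * k' + e * l') := by
    linear_combination h
  obtain ⟨h1, h2⟩ := eq_of_block_eq (hsmall i j) (hsmall k l) h'
  obtain ⟨h3, h4⟩ := eq_of_linear_eq hcop j.2 l.2 h1
  obtain ⟨h5, h6⟩ := eq_of_linear_eq hcop j'.2 l'.2 h2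
  rw [Fin.ext h3, Fin.ext h4, Fin.ext h5, Fin.ext h6]

lemma stepanov_count {p w e r s : ℕ} (hp : 2 ≤ p) (hw : 1 ≤ w) (hwp : w < p)
    (he : e ≤ (p - 1) * w) (hs : p ^ 4 ≤ s) (hsr : s ≤ r) :
    p * ((p * s * (r - e - 1) + p * s * (w * (p - 1)) + (s + 4 * w * p - 1) + w * (p - 1)) + 1)
      < (p * p) * ((r - e) * (s + 4 * w * p)) := by
  have hp2 : p ^ 2 * 4 ≤ s := by nlinarith [Nat.pow_le_pow_left hp 2]
  have hep : e ≤ p ^ 2 := by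
    have : (p - 1) * w ≤ p * p := Nat.mul_le_mul (Nat.sub_le _ _) hwp.le
    nlinarith
  obtain ⟨I, hI⟩ : ∃ I, r - e = I + 1 := ⟨r - e - 1, by have : 1 ≤ p ^ 2 := Nat.one_le_pow _ _ (by omega); omega⟩
  have hI3 : 3 * s ≤ 4 * (I + 1) := by omega
  rw [hI, Nat.add_sub_cancel]
  have hJ : s + 4 * w * p - 1 + 1 = s + 4 * w * p := by
    have : 1 ≤ 4 * w * p := Nat.mul_pos (by omega) (by omega)
    omega
  set J := s + 4 * w * p - 1
  have hw1 : w * (p - 1) ≤ w * p := Nat.mul_le_mul_left _ (Nat.sub_le _ _)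
  have h0 : p * s * (w * (p - 1)) ≤ p * s * (w * p) := Nat.mul_le_mul_left _ hw1
  have main : p * s * (w * p) + (s + 4 * w * p) + w * p < p * s + 4 * w * p * p * (I + 1) := by
    have h1 : w * p * p * (3 * s) ≤ w * p * p * (4 * (I + 1)) := Nat.mul_le_mul_left _ hI3
    have h2 : s < p * s := by nlinarith [Nat.one_le_pow 2 p (by omega)]
    have h3 : w * p * 5 ≤ w * p * (p * s) := Nat.mul_le_mul_left _ (by nlinarith)
    nlinarith
  have goal' : p * s * I + p * s * (w * (p - 1)) + J + w * (p - 1) + 1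
      < p * ((I + 1) * (s + 4 * w * p)) := by
    have : p * ((I + 1) * (s + 4 * w * p)) = p * s * I + (p * s + 4 * w * p * p * (I + 1)) := by ring
    rw [this]; omega
  calc _ < p * (p * ((I + 1) * (s + 4 * w * p))) := Nat.mul_lt_mul_of_pos_left goal' (by omega)
    _ = _ := by ring

lemma stepanov_degree {p w r s i i' j j' : ℕ} (hp : 2 ≤ p) (hw : 1 ≤ w)
    (hi : i < r) (hi' : i' < s + 4 * w * p) (hj : j < p) (hj' : j' < p) :
    i + p * r * i' + (j + p * r * j') * w ≤ s * (p * r) + 7 * w * p * (p * r) := by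
  have hR : r ≤ p * r := Nat.le_mul_of_pos_left _ (by omega)
  have h1 : p * r * i' ≤ p * r * (s + 4 * w * p) := Nat.mul_le_mul_left _ hi'.le
  have h2 : j * w ≤ p * w := Nat.mul_le_mul_right _ hj.le
  have h3 : p * r * j' * w ≤ p * r * p * w := Nat.mul_le_mul_right _ (Nat.mul_le_mul_left _ hj'.le)
  have hr1 : 1 ≤ p * r := by nlinarith
  have hwp : 1 ≤ w * p := Nat.mul_pos (by omega) (by omega)
  have h4 : p * w * 1 ≤ p * w * (p * r) := Nat.mul_le_mul_left _ hr1
  have h5 : 1 * (p * r) ≤ w * p * (p * r) := Nat.mul_le_mul_right _ hwp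
  nlinarith

lemma stepanov [IsAlgClosed K] {p : ℕ} [Fact p.Prime] [CharP K p] {F G : K[X]}
    (hFG : F.natDegree ≤ G.natDegree) (hG1 : 1 ≤ G.natDegree) (hGp : G.natDegree < p)
    (hco : ∀ β, G.eval β = 0 → F.eval β ≠ 0) {μ ν : ℕ} (hμ : 4 ≤ μ) (hμν : μ ≤ ν) (a : K)
    (S : Finset K) (y : K → K)
    (hS : ∀ x ∈ S, G.eval x ≠ 0 ∧ y x ^ p - y x = F.eval x / G.eval x)
    (hSq : ∀ x ∈ S, x ^ p ^ (μ + ν + 2) = x ∧ G.eval x ^ p ^ (μ + ν + 2) = G.eval x ∧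
      y x ^ p ^ (μ + ν + 2) = y x + a) :
    S.card ≤ p ^ μ * (p * p ^ ν) + 7 * G.natDegree * p * (p * p ^ ν) := by
  classical
  have hp := (Fact.out : p.Prime)
  obtain ⟨β, hβ⟩ := IsAlgClosed.exists_root G (by
    rw [degree_eq_natDegree (by rintro rfl; simp at hG1)]
    exact_mod_cast (by omega : G.natDegree ≠ 0))
  have hG0 : G ≠ 0 := by rintro rfl; simp at hG1
  obtain ⟨G₁, hG, hG₁⟩ := exists_eq_pow_rootMultiplicity_mul_and_not_dvd G hG0 β
  set d := rootMultiplicity β G with hd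
  have hd0 : 0 < d := (rootMultiplicity_pos hG0).2 hβ
  have hdw : d ≤ G.natDegree := by
    rw [hd, ← count_roots]
    exact (Multiset.count_le_card _ _).trans (card_roots' _)
  rw [dvd_iff_isRoot] at hG₁
  set w := G.natDegree with hw
  set s := p ^ μ with hs
  set r := p ^ ν with hr
  set e := (p - 1) * d with he
  set t := p * s * (r - e - 1) + p * s * (w * (p - 1)) + (s + 4 * w * p - 1) + w * (p - 1) with ht
  have hΦ := monic_asPoly p hp.one_lt F G
  have hΦdeg := natDegree_asPoly p hp.one_lt F G
  let q := p ^ (μ + ν + 2)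
  have hq : q = p * r * (p * s) := by simp only [q, hs, hr]; ring
  let D : (Fin p × Fin p) × (Fin (r - e) × Fin (s + 4 * w * p)) → K[X][X] := fun k =>
    C ((X - C β) ^ ((k.2.1 : ℕ) * (p * s)) * (X - C (β ^ q)) ^ (k.2.2 : ℕ)) *
      (X ^ ((k.1.1 : ℕ) * (p * s)) * (X + C (C a * G)) ^ (k.1.2 : ℕ))
  have hD : ∀ k, WDegLE w t (D k) := by
    rintro ⟨⟨j, j'⟩, ⟨i, i'⟩⟩
    have hYG : WDegLE w w (X + C (C a * G) : K[X][X]) :=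
      wDegLE_X.add (wDegLE_C (natDegree_C_mul_le _ _))
    have h1 : ((X - C β) ^ ((i : ℕ) * (p * s)) * (X - C (β ^ q)) ^ (i' : ℕ)).natDegree
        ≤ (i : ℕ) * (p * s) + i' := by
      refine natDegree_mul_le.trans ?_
      rw [natDegree_pow, natDegree_pow, natDegree_X_sub_C, natDegree_X_sub_C, mul_one, mul_one]
    refine ((wDegLE_C h1).mul ((wDegLE_X.pow _).mul (hYG.pow _))).mono ?_
    have hi := i.2
    have hi' := i'.2
    have hj := j.2
    have hj' := j'.2
    have e1 : (i : ℕ) * (p * s) ≤ (r - e - 1) * (p * s) := Nat.mul_le_mul_right _ (by omega)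
    have e2 : (j : ℕ) * (p * s) * w ≤ (p - 1) * (p * s) * w :=
      Nat.mul_le_mul_right _ (Nat.mul_le_mul_right _ (by omega))
    have e3 : (j' : ℕ) * w ≤ (p - 1) * w := Nat.mul_le_mul_right _ (by omega)
    have e4 : (r - e - 1) * (p * s) = p * s * (r - e - 1) := mul_comm _ _
    have e5 : (p - 1) * (p * s) * w = p * s * (w * (p - 1)) := by ring
    have e6 : (p - 1) * w = w * (p - 1) := mul_comm _ _
    simp only [ht]
    omega
  obtain ⟨γ, hγ, hdvd⟩ := exists_relation_mod (w := w) hΦ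
    (by rw [hΦdeg]; exact wDegLE_asPoly p hp.one_lt hFG) D hD (by
      rw [hΦdeg]
      simp only [Fintype.card_prod, Fintype.card_fin]
      refine stepanov_count hp.two_le hG1 hGp (Nat.mul_le_mul_left _ hdw) ?_ ?_
      · exact Nat.pow_le_pow_right hp.pos hμ
      · exact Nat.pow_le_pow_right hp.pos hμν)
  have hps : 0 < p * s := Nat.mul_pos hp.pos (pow_pos hp.pos _)
  choose c hc using fun k => IsAlgClosed.exists_pow_nat_eq (γ k) hps
  have hc0 : ∃ k, c k ≠ 0 := by
    obtain ⟨k, hk⟩ := hγ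
    refine ⟨k, fun h0 => hk ?_⟩
    rw [← hc k, h0, zero_pow hps.ne']
  have hnd := not_asPoly_dvd_sum p hp.one_lt F G G₁ β d hd0 hG hG₁ (hco β hβ)
    (fun k : (Fin p × Fin p) × (Fin (r - e) × Fin (s + 4 * w * p)) =>
      (k.2.1 : ℕ) + p * r * k.2.2) (fun k => (k.1.1 : ℕ) + p * r * k.1.2)
    (stepanov_exponent_injective hp hd0 (hdw.trans_lt hGp)) c hc0
  refine card_le_of_vanishing hFG ?_ hnd S y hS ?_
  · refine wDegLE_sum _ _ fun k _ => ?_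
    have h1 : ((X - C β) ^ ((k.2.1 : ℕ) + p * r * k.2.2)).natDegree
        ≤ (k.2.1 : ℕ) + p * r * k.2.2 := by
      rw [natDegree_pow, natDegree_X_sub_C, mul_one]
    refine ((wDegLE_C (t := 0) (by simp)).mul ((wDegLE_C h1).mul (wDegLE_X.pow _))).mono ?_
    rw [zero_add]
    exact stepanov_degree hp.two_le hG1 (by have := k.2.1.2; omega) k.2.2.2 k.1.1.2 k.1.2.2
  · intro x hx k
    obtain ⟨hGx, hyx⟩ := hS x hx
    obtain ⟨hxq, hGq, hyq⟩ := hSq x hx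
    set z := G.eval x * (y x + k) with hz
    have hzΦ : evalTwo x z (asPoly p F G) = 0 := by
      refine evalTwo_asPoly hp.one_lt hGx ?_
      rw [add_pow_char, ← hyx]
      have : ((k : ℕ) : K) ^ p = (k : ℕ) := by
        have := map_natCast (frobenius K p) k
        rwa [frobenius_def] at this
      rw [this]; ring
    have hzq : z ^ q = z + a * G.eval x := by
      have hk : ((k : ℕ) : K) ^ q = (k : ℕ) := by
        have := map_natCast (iterateFrobenius K p (μ + ν + 2)) k
        rwa [iterateFrobenius_def] at this
      rw [hz, mul_pow, hGq, add_pow_char_pow, hyq, hk]; ring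
    have hxβ : (x - β) ^ q = x - β ^ q := by
      rw [sub_pow_char_pow, hxq]
    have hDz : ∑ k, γ k * evalTwo x z (D k) = 0 := by
      obtain ⟨f, hf⟩ := hdvd
      have := congrArg (evalTwo x z) hf
      rw [map_mul, hzΦ, zero_mul, map_sum] at this
      simpa using this
    refine (pow_eq_zero_iff hps.ne').1 ?_
    rw [map_sum, ← hDz]
    have hpsp : p * s = p ^ (μ + 1) := by rw [hs, pow_succ, mul_comm]
    rw [hpsp, sum_pow_char_pow]
    refine Finset.sum_congr rfl fun k _ => ?_
    rw [← hpsp]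
    simp only [D, map_mul, evalTwo_C, map_pow, evalTwo_X, map_add, eval_C, eval_pow, eval_sub,
      eval_X]
    rw [mul_pow, hc, mul_pow, ← hxβ, mul_comm a, mul_comm (G.eval x) a, ← hzq, hq]
    ring

end StepanovBound

section WeilBound
variable (p : ℕ) [Fact p.Prime]

open Classical in
lemma frobPoints_one :
    frobPoints p 1 = Finset.univ.image (algebraMap (ZMod p) (AlgebraicClosure (ZMod p))) := by
  symm
  refine Finset.eq_of_subset_of_card_le ?_ ?_
  · intro x hx
    obtain ⟨a, -, rfl⟩ := Finset.mem_image.1 hx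
    rw [mem_frobPoints p one_ne_zero, pow_one, ← map_pow, ZMod.pow_card]
  · rw [card_frobPoints p one_ne_zero, Finset.card_image_of_injective _
      (algebraMap (ZMod p) (AlgebraicClosure (ZMod p))).injective,
      Finset.card_univ, ZMod.card, pow_one]

variable {p}

lemma exists_algebraMap_eq {x : AlgebraicClosure (ZMod p)} (hx : x ^ p = x) :
    ∃ a, algebraMap (ZMod p) (AlgebraicClosure (ZMod p)) a = x := by
  classical
  have : x ∈ frobPoints p 1 := by rwa [mem_frobPoints p one_ne_zero, pow_one]
  rw [frobPoints_one] at this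
  obtain ⟨a, -, ha⟩ := Finset.mem_image.1 this
  exact ⟨a, ha⟩

variable (F G : (ZMod p)[X])

/-- The trace of the value of `F / G` at a point over the field with `p ^ n` elements. -/
def traceVal (n : ℕ) (x : AlgebraicClosure (ZMod p)) : AlgebraicClosure (ZMod p) :=
  ∑ i ∈ Finset.range n, fracVal F G x ^ p ^ i

lemma traceVal_pow {n : ℕ} (hn : n ≠ 0) {x : AlgebraicClosure (ZMod p)}
    (hx : x ∈ frobPoints p n) : traceVal F G n x ^ p = traceVal F G n x := by
  rw [mem_frobPoints p hn] at hx
  have hv : fracVal F G x ^ p ^ n = fracVal F G x := by rw [← fracVal_pow, hx]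
  rw [traceVal, sum_pow_char]
  simp only [← pow_mul, ← pow_succ]
  have h1 := Finset.sum_range_succ (fun i => fracVal F G x ^ p ^ i) n
  rw [Finset.sum_range_succ'] at h1
  rw [hv, pow_zero, pow_one] at h1
  exact add_right_cancel h1

open Classical in
/-- The points over the field with `p ^ n` elements at which the trace of `F / G` is `a`. -/
def tracePoints (n : ℕ) (a : ZMod p) : Finset (AlgebraicClosure (ZMod p)) :=
  (frobPoints p n).filter fun x => aeval x G ≠ 0 ∧ traceVal F G n x = algebraMap _ _ a

variable {F G}

lemma card_tracePoints_le_of_ten_le (hFG : F.natDegree ≤ G.natDegree) (hG1 : 1 ≤ G.natDegree)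
    (hGp : G.natDegree < p) (hco : IsCoprime F G) {μ ν : ℕ} (hμ : 4 ≤ μ) (hμν : μ ≤ ν)
    (a : ZMod p) : (tracePoints F G (μ + ν + 2) a).card ≤
      p ^ μ * (p * p ^ ν) + 7 * G.natDegree * p * (p * p ^ ν) := by
  classical
  set ι := algebraMap (ZMod p) (AlgebraicClosure (ZMod p)) with hι
  have hp := (Fact.out : p.Prime)
  have hy : ∀ x, ∃ y : AlgebraicClosure (ZMod p), y ^ p - y = fracVal F G x := by
    intro x
    have hdeg : (X ^ p - (X + C (fracVal F G x)) : (AlgebraicClosure (ZMod p))[X]).degree ≠ 0 := by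
      have h1 : (X + C (fracVal F G x) : (AlgebraicClosure (ZMod p))[X]).natDegree <
          (X ^ p : (AlgebraicClosure (ZMod p))[X]).natDegree := by
        rw [natDegree_X_pow, natDegree_X_add_C]; exact hp.one_lt
      have h2 := natDegree_sub_eq_left_of_natDegree_lt h1
      rw [natDegree_X_pow] at h2
      intro h
      have := natDegree_eq_zero_iff_degree_le_zero.2 h.le
      have := hp.one_lt
      omega
    obtain ⟨y, hy⟩ := IsAlgClosed.exists_root _ hdeg
    refine ⟨y, ?_⟩
    simp at hy
    linear_combination hy
  choose y hy using hy
  have htel : ∀ (n : ℕ) (x : AlgebraicClosure (ZMod p)),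
      y x ^ p ^ n = y x + traceVal F G n x := by
    intro n x
    induction n with
    | zero => simp [traceVal]
    | succ n ih =>
      have h1 : (y x ^ p - y x) ^ p ^ n = fracVal F G x ^ p ^ n := by rw [hy]
      rw [sub_pow_char_pow, ← pow_mul, ← pow_succ'] at h1
      rw [traceVal, Finset.sum_range_succ, ← add_assoc, ← traceVal, ← ih]
      linear_combination h1
  have := stepanov (p := p) (F := F.map ι) (G := G.map ι) (by simpa using hFG) (by simpa using hG1)
    (by simpa using hGp) (fun β hβ h0 => by
      rw [hι, eval_map_algebraMap] at hβ h0
      exact aeval_ne_zero_of_isCoprime G hco h0 hβ) hμ hμν (ι a)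
    (tracePoints F G (μ + ν + 2) a) y ?_ ?_
  · simpa using this
  · intro x hx
    rw [tracePoints, Finset.mem_filter] at hx
    rw [hι, eval_map_algebraMap, eval_map_algebraMap, hy]
    exact ⟨hx.2.1, rfl⟩
  · intro x hx
    rw [tracePoints, Finset.mem_filter, mem_frobPoints p (by omega)] at hx
    refine ⟨hx.1, ?_, ?_⟩
    · rw [hι, eval_map_algebraMap, ← aeval_pow_prime_pow, hx.1]
    · rw [htel, hx.2.2]

lemma card_tracePoints_le (hFG : F.natDegree ≤ G.natDegree) (hG1 : 1 ≤ G.natDegree)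
    (hGp : G.natDegree < p) (hco : IsCoprime F G) {n : ℕ} (hn : 1 ≤ n) (a : ZMod p) :
    ((tracePoints F G n a).card : ℝ) ≤
      (p : ℝ) ^ (n - 1) + (7 * G.natDegree * p ^ 2 + p ^ 10) * √p ^ n := by
  classical
  have hp := (Fact.out : p.Prime)
  have hp1 : (1 : ℝ) ≤ p := by exact_mod_cast hp.one_le
  have hsp : 1 ≤ √(p : ℝ) := Real.one_le_sqrt.2 hp1
  have hsq : √(p : ℝ) ^ 2 = p := Real.sq_sqrt (by positivity)
  have hsn : 1 ≤ √(p : ℝ) ^ n := one_le_pow₀ hsp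
  by_cases h10 : n < 10
  · have h1 : ((tracePoints F G n a).card : ℝ) ≤ (p : ℝ) ^ n := by
      have := Finset.card_le_card (Finset.filter_subset
        (fun x => aeval x G ≠ 0 ∧ traceVal F G n x = algebraMap _ _ a) (frobPoints p n))
      rw [card_frobPoints p (by omega)] at this
      exact_mod_cast this
    have h2 : (p : ℝ) ^ n ≤ (p : ℝ) ^ 10 := pow_le_pow_right₀ hp1 h10.le
    have h3 : (p : ℝ) ^ 10 * 1 ≤ (p : ℝ) ^ 10 * √p ^ n := by gcongr
    have h4 : 0 ≤ 7 * (G.natDegree : ℝ) * p ^ 2 * √p ^ n := by positivity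
    have h5 : (0 : ℝ) ≤ (p : ℝ) ^ (n - 1) := by positivity
    linarith
  · obtain ⟨μ, ν, hμ, hμν, hνμ, rfl⟩ : ∃ μ ν, 4 ≤ μ ∧ μ ≤ ν ∧ ν ≤ μ + 1 ∧ n = μ + ν + 2 :=
      ⟨(n - 2) / 2, n - 2 - (n - 2) / 2, by omega, by omega, by omega, by omega⟩
    have h1 := card_tracePoints_le_of_ten_le hFG hG1 hGp hco hμ hμν a
    have h2 : ((tracePoints F G (μ + ν + 2) a).card : ℝ) ≤
        (p : ℝ) ^ μ * (p * p ^ ν) + 7 * G.natDegree * p * (p * p ^ ν) := by exact_mod_cast h1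
    have h3 : (p : ℝ) ^ μ * (p * p ^ ν) = (p : ℝ) ^ (μ + ν + 2 - 1) := by
      rw [show μ + ν + 2 - 1 = μ + ν + 1 by omega]; ring
    have h4 : (p : ℝ) * p ^ ν ≤ p * √p ^ (μ + ν + 2) := by
      have h5 : (p : ℝ) ^ ν = √p ^ (2 * ν) := by rw [pow_mul, hsq]
      rw [h5]
      gcongr
      omega
    have h6 : 7 * G.natDegree * p * (p * (p : ℝ) ^ ν) ≤
        7 * G.natDegree * p * (p * √p ^ (μ + ν + 2)) := by gcongr
    have h7 : 0 ≤ (p : ℝ) ^ 10 * √p ^ (μ + ν + 2) := by positivity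
    rw [h3] at h2
    nlinarith

lemma norm_expSum_le (Ψ : AddChar (AlgebraicClosure (ZMod p)) ℂ) (ψ : AddChar (ZMod p) ℂ)
    (hψ : ψ ≠ 0) (hΨ : ∀ a, Ψ (algebraMap _ _ a) = ψ a)
    (hFG : F.natDegree ≤ G.natDegree) (hG1 : 1 ≤ G.natDegree)
    (hGp : G.natDegree < p) (hco : IsCoprime F G) {n : ℕ} (hn : 1 ≤ n) :
    ‖expSum F G Ψ n‖ ≤ (p * (7 * G.natDegree * p ^ 2 + p ^ 10) + G.natDegree) * √p ^ n := by
  classical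
  have hp := (Fact.out : p.Prime)
  have hp1 : (1 : ℝ) ≤ p := by exact_mod_cast hp.one_le
  have hsn : 1 ≤ √(p : ℝ) ^ n := one_le_pow₀ (Real.one_le_sqrt.2 hp1)
  set M : ℝ := (p : ℝ) ^ (n - 1) + (7 * G.natDegree * p ^ 2 + p ^ 10) * √p ^ n with hM
  have hval : expSum F G Ψ n = ∑ a, ((tracePoints F G n a).card : ℂ) * ψ a := by
    rw [expSum, ← Finset.sum_filter]
    have hmaps : ∀ x ∈ (frobPoints p n).filter (fun x => aeval x G ≠ 0),
        ∃ a, algebraMap (ZMod p) _ a = traceVal F G n x := fun x hx =>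
      exists_algebraMap_eq (traceVal_pow F G (by omega) (Finset.mem_filter.1 hx).1)
    have : ∀ x ∈ (frobPoints p n).filter (fun x => aeval x G ≠ 0),
        Ψ (∑ i ∈ Finset.range n, fracVal F G x ^ p ^ i) =
          ∑ a : ZMod p, if traceVal F G n x = algebraMap _ _ a then ψ a else 0 := by
      intro x hx
      obtain ⟨a, ha⟩ := hmaps x hx
      rw [← traceVal, ← ha, hΨ]
      simp [(algebraMap (ZMod p) (AlgebraicClosure (ZMod p))).injective.eq_iff]
    rw [Finset.sum_congr rfl this, Finset.sum_comm]
    refine Finset.sum_congr rfl fun a _ => ?_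
    rw [← Finset.sum_filter, Finset.filter_filter, Finset.sum_const, nsmul_eq_mul, tracePoints]
  have hsum0 : ∑ a, ψ a = 0 := AddChar.sum_eq_zero_iff_ne_zero.2 hψ
  have hval' : expSum F G Ψ n = ∑ a, ((((tracePoints F G n a).card : ℝ) - M : ℝ) : ℂ) * ψ a := by
    rw [hval]
    push_cast
    simp only [sub_mul, Finset.sum_sub_distrib, ← Finset.mul_sum, hsum0, mul_zero, sub_zero]
  have hle : ∀ a, ((tracePoints F G n a).card : ℝ) ≤ M :=
    card_tracePoints_le hFG hG1 hGp hco hn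
  have hcover : (p : ℝ) ^ n ≤ ∑ a, ((tracePoints F G n a).card : ℝ) + G.natDegree := by
    have hG0 : G.map (algebraMap (ZMod p) (AlgebraicClosure (ZMod p))) ≠ 0 := by
      intro h0
      rw [Polynomial.map_eq_zero] at h0
      rw [h0] at hG1; simp at hG1
    have h1 : frobPoints p n ⊆ (Finset.univ.biUnion fun a => tracePoints F G n a) ∪
        (G.aroots (AlgebraicClosure (ZMod p))).toFinset := by
      intro x hx
      rw [Finset.mem_union, Finset.mem_biUnion]
      by_cases h0 : aeval x G = 0
      · right
        rw [Multiset.mem_toFinset, mem_roots hG0, IsRoot, eval_map_algebraMap, h0]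
      · left
        obtain ⟨a, ha⟩ := exists_algebraMap_eq (traceVal_pow F G (by omega) hx)
        exact ⟨a, Finset.mem_univ _, Finset.mem_filter.2 ⟨hx, h0, ha.symm⟩⟩
    have h2 := (Finset.card_le_card h1).trans (Finset.card_union_le _ _)
    rw [card_frobPoints p (by omega)] at h2
    have h3 : (G.aroots (AlgebraicClosure (ZMod p))).toFinset.card ≤ G.natDegree :=
      (Multiset.toFinset_card_le _).trans ((card_roots' _).trans natDegree_map_le)
    have h4 : (Finset.univ.biUnion fun a => tracePoints F G n a).card ≤
      ∑ a, (tracePoints F G n a).card := Finset.card_biUnion_le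
    exact_mod_cast (by omega : p ^ n ≤ ∑ a, (tracePoints F G n a).card + G.natDegree)
  calc ‖expSum F G Ψ n‖ ≤ ∑ a : ZMod p, (M - (tracePoints F G n a).card) := by
        rw [hval']
        refine (norm_sum_le _ _).trans (Finset.sum_le_sum fun a _ => ?_)
        rw [norm_mul, AddChar.norm_apply, mul_one, Complex.norm_real, Real.norm_eq_abs,
          abs_of_nonpos (sub_nonpos.2 (hle a)), neg_sub]
    _ = p * M - ∑ a, ((tracePoints F G n a).card : ℝ) := by
        rw [Finset.sum_sub_distrib, Finset.sum_const, Finset.card_univ, ZMod.card, nsmul_eq_mul]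
    _ ≤ p * M - p ^ n + G.natDegree := by linarith
    _ = p * ((7 * G.natDegree * p ^ 2 + p ^ 10) * √p ^ n) + G.natDegree * 1 := by
        have : (p : ℝ) ^ n = p * p ^ (n - 1) := by
          rw [← pow_succ', Nat.sub_add_cancel hn]
        rw [hM, this]; ring
    _ ≤ p * ((7 * G.natDegree * p ^ 2 + p ^ 10) * √p ^ n) + G.natDegree * √p ^ n := by gcongr
    _ = _ := by ring

lemma exists_addChar_extension (ψ : AddChar (ZMod p) ℂ) :
    ∃ Ψ : AddChar (AlgebraicClosure (ZMod p)) ℂ, ∀ a, Ψ (algebraMap _ _ a) = ψ a := by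
  obtain ⟨f, hf⟩ := (Algebra.linearMap (ZMod p) (AlgebraicClosure (ZMod p))).exists_leftInverse_of_injective
    (LinearMap.ker_eq_bot.2 (algebraMap (ZMod p) (AlgebraicClosure (ZMod p))).injective)
  refine ⟨ψ.compAddMonoidHom f.toAddMonoidHom, fun a => ?_⟩
  rw [AddChar.compAddMonoidHom_apply]
  congr 1
  exact LinearMap.congr_fun hf a

/-- The Weil bound for additive character sums of a rational function vanishing at infinity. -/
lemma norm_sum_addChar_div_le (ψ : AddChar (ZMod p) ℂ) (hψ : ψ ≠ 0) (hG : G.Monic)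
    (hFG : F.degree < G.degree) (hG1 : 1 ≤ G.natDegree) (hGp : G.natDegree < p)
    (hco : IsCoprime F G) :
    ‖∑ t : ZMod p, if G.eval t ≠ 0 then ψ (F.eval t / G.eval t) else 0‖
      ≤ 2 * G.natDegree * √p := by
  classical
  obtain ⟨Ψ, hΨ⟩ := exists_addChar_extension ψ
  have hp1 : (1 : ℝ) < p := by exact_mod_cast (Fact.out : p.Prime).one_lt
  have h := norm_expSum_one_le Ψ hG hG1 hFG
    (p * (7 * G.natDegree * p ^ 2 + p ^ 10) + G.natDegree) √p
    (Real.sqrt_pos.2 (by linarith)) (by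
      rw [Real.sqrt_lt' (by linarith)]; nlinarith)
    (fun n hn => norm_expSum_le Ψ ψ hψ hΨ (natDegree_le_natDegree hFG.le) hG1 hGp hco hn)
  convert h using 2
  rw [expSum, frobPoints_one, Finset.sum_image (fun _ _ _ _ h => (algebraMap _ _).injective h)]
  refine Finset.sum_congr rfl fun t _ => ?_
  rw [aeval_algebraMap_apply, Finset.sum_range_one, pow_zero, pow_one, fracVal,
    aeval_algebraMap_apply, aeval_algebraMap_apply, ← map_div₀, hΨ]
  simp [coe_aeval_eq_eval]

end WeilBound

section Mobius

lemma aeval_reflect {k A : Type} [Field k] [Field A] [Algebra k A] {m : ℕ} {h : k[X]}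
    (hm : h.natDegree ≤ m) {a : A} (ha : a ≠ 0) :
    aeval a (reflect m h) = a ^ m * aeval a⁻¹ h := by
  let _ : Invertible a⁻¹ := invertibleOfNonzero (inv_ne_zero ha)
  have := eval₂_reflect_mul_pow (algebraMap k A) a⁻¹ m h hm
  rw [invOf_eq_inv, inv_inv] at this
  rw [aeval_def, aeval_def, ← this, mul_comm (eval₂ _ _ _), ← mul_assoc, inv_pow,
    mul_inv_cancel₀ (pow_ne_zero _ ha), one_mul]

lemma isCoprime_reflect {k : Type} [Field k] {f g : k[X]} (h : IsCoprime f g) {m : ℕ}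
    (hm : max f.natDegree g.natDegree = m) : IsCoprime (reflect m f) (reflect m g) := by
  have hf : f.natDegree ≤ m := hm ▸ le_max_left _ _
  have hg : g.natDegree ≤ m := hm ▸ le_max_right _ _
  refine (isCoprime_iff_aeval_ne_zero_of_isAlgClosed k (AlgebraicClosure k) _ _).2 fun a => ?_
  replace h := (isCoprime_iff_aeval_ne_zero_of_isAlgClosed k (AlgebraicClosure k) _ _).1 h
  by_cases ha : a = 0
  · subst ha
    simp only [← coeff_zero_eq_aeval_zero', coeff_reflect, revAt_zero, ne_eq,
      map_eq_zero]
    by_contra! hcon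
    have hf0 : f.natDegree = m → f = 0 := fun e => by
      rw [← leadingCoeff_eq_zero, leadingCoeff, e]; exact hcon.1
    have hg0 : g.natDegree = m → g = 0 := fun e => by
      rw [← leadingCoeff_eq_zero, leadingCoeff, e]; exact hcon.2
    rcases max_choice f.natDegree g.natDegree with e | e
    · have hf1 := hf0 (e ▸ hm)
      have hm0 : m = 0 := by rw [← hm, e, hf1, natDegree_zero]
      have hg1 := hg0 (by omega)
      rcases h 0 with h | h <;> simp [hf1, hg1] at h
    · have hg1 := hg0 (e ▸ hm)
      have hm0 : m = 0 := by rw [← hm, e, hg1, natDegree_zero]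
      have hf1 := hf0 (by omega)
      rcases h 0 with h | h <;> simp [hf1, hg1] at h
  · rw [aeval_reflect hf ha, aeval_reflect hg ha]
    exact (h a⁻¹).imp (mul_ne_zero (pow_ne_zero _ ha)) (mul_ne_zero (pow_ne_zero _ ha))

/-- A change of variable moving infinity to a point which is not a pole. -/
lemma exists_vanishing_at_infinity {k : Type} [Field k] {f g : k[X]} (h : IsCoprime f g) {c : k}
    (hc : g.eval c ≠ 0) {m : ℕ} (hm : max f.natDegree g.natDegree = m) :
    ∃ (F G : k[X]) (l : k), G.Monic ∧ G.natDegree = m ∧ F.degree < G.degree ∧ IsCoprime F G ∧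
      ∀ t, t ≠ 0 → (G.eval t ≠ 0 ↔ g.eval (c + t⁻¹) ≠ 0) ∧
        (g.eval (c + t⁻¹) ≠ 0 → f.eval (c + t⁻¹) / g.eval (c + t⁻¹) = l + F.eval t / G.eval t) := by
  set f₁ := f.comp (X + C c) with hf₁
  set g₁ := g.comp (X + C c) with hg₁
  have hdf : f₁.natDegree = f.natDegree := by rw [hf₁, natDegree_comp, natDegree_X_add_C, mul_one]
  have hdg : g₁.natDegree = g.natDegree := by rw [hg₁, natDegree_comp, natDegree_X_add_C, mul_one]
  have hm₁ : max f₁.natDegree g₁.natDegree = m := by rw [hdf, hdg, hm]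
  have hf₁m : f₁.natDegree ≤ m := hm₁ ▸ le_max_left _ _
  have hg₁m : g₁.natDegree ≤ m := hm₁ ▸ le_max_right _ _
  have hcop₁ : IsCoprime f₁ g₁ := h.map (compRingHom (X + C c))
  have hcop := isCoprime_reflect hcop₁ hm₁
  set A := reflect m f₁ with hA
  set B := reflect m g₁ with hB
  have hBm : B.coeff m = g.eval c := by
    rw [hB, coeff_reflect, revAt_le le_rfl, Nat.sub_self, hg₁, coeff_zero_eq_eval_zero, eval_comp]
    simp
  have hAm : A.coeff m = f.eval c := by
    rw [hA, coeff_reflect, revAt_le le_rfl, Nat.sub_self, hf₁, coeff_zero_eq_eval_zero, eval_comp]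
    simp
  have hBd : B.natDegree ≤ m := natDegree_reflect_le.trans (max_le le_rfl hg₁m)
  have hAd : A.natDegree ≤ m := natDegree_reflect_le.trans (max_le le_rfl hf₁m)
  set b := g.eval c with hb
  have hBdeg : B.natDegree = m := natDegree_eq_of_le_of_coeff_ne_zero hBd (by rwa [hBm])
  have hBlead : B.leadingCoeff = b := by rw [leadingCoeff, hBdeg, hBm]
  have hGmonic : (C b⁻¹ * B).Monic := by
    rw [Monic, leadingCoeff_C_mul_of_isUnit (isUnit_iff_ne_zero.2 (inv_ne_zero hc)), hBlead,
      inv_mul_cancel₀ hc]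
  have hGdeg : (C b⁻¹ * B).natDegree = m := by
    rw [natDegree_C_mul (inv_ne_zero hc), hBdeg]
  refine ⟨C b⁻¹ * (A - C (f.eval c / b) * B), C b⁻¹ * B, f.eval c / b, hGmonic, hGdeg, ?_, ?_, ?_⟩
  · rw [degree_eq_natDegree hGmonic.ne_zero, hGdeg, degree_lt_iff_coeff_zero]
    intro j hj
    rw [coeff_C_mul, coeff_sub, coeff_C_mul]
    rcases hj.eq_or_lt with rfl | hj
    · rw [hAm, hBm, div_mul_cancel₀ _ hc, sub_self, mul_zero]
    · rw [coeff_eq_zero_of_natDegree_lt (hAd.trans_lt hj),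
        coeff_eq_zero_of_natDegree_lt (hBd.trans_lt hj)]
      simp
  · have hu : IsUnit (C b⁻¹ : k[X]) := isUnit_C.2 (isUnit_iff_ne_zero.2 (inv_ne_zero hc))
    refine (isCoprime_mul_unit_left_left hu _ _).2 ((isCoprime_mul_unit_left_right hu _ _).2 ?_)
    have : A - C (f.eval c / b) * B = A + -C (f.eval c / b) * B := by ring
    rw [this]
    exact IsCoprime.add_mul_right_left hcop _
  · intro t ht
    have hBt : B.eval t = t ^ m * g.eval (c + t⁻¹) := by
      have := aeval_reflect (A := k) hg₁m ht
      rw [coe_aeval_eq_eval, coe_aeval_eq_eval] at this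
      rw [hB, this, hg₁, eval_comp]; simp [add_comm]
    have hAt : A.eval t = t ^ m * f.eval (c + t⁻¹) := by
      have := aeval_reflect (A := k) hf₁m ht
      rw [coe_aeval_eq_eval, coe_aeval_eq_eval] at this
      rw [hA, this, hf₁, eval_comp]; simp [add_comm]
    have htm : t ^ m ≠ 0 := pow_ne_zero _ ht
    simp only [eval_mul, eval_C, eval_sub, hBt, hAt]
    refine ⟨by simp [hc, ht], fun hg => ?_⟩
    generalize f.eval (c + t⁻¹) = u at *
    generalize g.eval (c + t⁻¹) = v at *
    field_simp
    ring

end Mobius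

section RationalWeil
variable {p : ℕ} [Fact p.Prime]

/-- The Weil bound for additive character sums of a nonconstant rational function. -/
lemma norm_sum_addChar_ratio_le (ψ : AddChar (ZMod p) ℂ) (hψ : ψ ≠ 0) {f g : (ZMod p)[X]}
    (h : IsCoprime f g) (hg : g ≠ 0) {m : ℕ} (hm : max f.natDegree g.natDegree = m) (hm1 : 1 ≤ m)
    (hmp : m < p) :
    ‖∑ y : ZMod p, if g.eval y ≠ 0 then ψ (f.eval y / g.eval y) else 0‖ ≤ 2 + 2 * m * √p := by
  obtain ⟨c, hc⟩ : ∃ c, g.eval c ≠ 0 := by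
    by_contra! hcon
    refine hg (eq_zero_of_natDegree_lt_card_of_eval_eq_zero g Function.injective_id hcon ?_)
    rw [ZMod.card]
    exact (hm ▸ le_max_right _ _ : g.natDegree ≤ m).trans_lt hmp
  obtain ⟨F, G, l, hGm, hGd, hFG, hco, ht⟩ := exists_vanishing_at_infinity h hc hm
  have hW := norm_sum_addChar_div_le ψ hψ hGm hFG (hGd.symm ▸ hm1) (hGd.symm ▸ hmp) hco
  rw [hGd] at hW
  set u : ZMod p → ℂ := fun y => if g.eval y ≠ 0 then ψ (f.eval y / g.eval y) else 0 with hu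
  set v : ZMod p → ℂ := fun t => if G.eval t ≠ 0 then ψ (F.eval t / G.eval t) else 0 with hv
  have hre : ∑ y, u y = ∑ t, u (c + t⁻¹) :=
    (Equiv.sum_comp ((Equiv.inv (ZMod p)).trans (Equiv.addLeft c)) u).symm
  have hu1 : ∀ y, ‖u y‖ ≤ 1 := fun y => by
    simp only [hu]; split_ifs <;> simp
  have hv1 : ∀ y, ‖v y‖ ≤ 1 := fun y => by
    simp only [hv]; split_ifs <;> simp
  have hdiff : ∑ t, (u (c + t⁻¹) - ψ l * v t) = u (c + 0⁻¹) - ψ l * v 0 := by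
    refine Fintype.sum_eq_single 0 fun t h0 => ?_
    obtain ⟨h1, h2⟩ := ht t h0
    by_cases h3 : g.eval (c + t⁻¹) = 0
    · have h4 : G.eval t = 0 := by
        by_contra h4; exact h1.1 h4 h3
      simp [hu, hv, h3, h4]
    · have h4 : G.eval t ≠ 0 := h1.2 h3
      simp only [hu, hv, if_pos h3, if_pos h4, h2 h3, AddChar.map_add_eq_mul, sub_self]
  have : ∑ y, u y = (u (c + 0⁻¹) - ψ l * v 0) + ψ l * ∑ t, v t := by
    rw [hre, ← hdiff, Finset.sum_sub_distrib, ← Finset.mul_sum]; ring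
  rw [this]
  refine (norm_add_le _ _).trans (add_le_add ((norm_sub_le _ _).trans ?_) ?_)
  · rw [norm_mul, AddChar.norm_apply, one_mul]
    linarith [hu1 (c + 0⁻¹), hv1 0]
  · rw [norm_mul, AddChar.norm_apply, one_mul]; exact hW

end RationalWeil

section Reduction

lemma exists_integer_multiple (f : ℚ[X]) :
    ∃ (b : ℤ) (f₀ : ℤ[X]), b ≠ 0 ∧ f₀.map (Int.castRingHom ℚ) = C (b : ℚ) * f := by
  obtain ⟨b, hbM, hb⟩ := IsLocalization.integerNormalization_spec (nonZeroDivisors ℤ) f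
  refine ⟨b, IsLocalization.integerNormalization (nonZeroDivisors ℤ) f,
    nonZeroDivisors.ne_zero hbM, ?_⟩
  rw [← algebraMap_int_eq, hb]
  ext n
  simp

lemma coeff_polyRed (p : ℕ) (f : ℚ[X]) (n : ℕ) : (polyRed p f).coeff n = ratRed p (f.coeff n) := by
  rw [polyRed, Polynomial.sum_def, finsetSum_coeff]
  simp only [coeff_C_mul, coeff_X_pow]
  by_cases hn : f.coeff n = 0
  · rw [hn]
    simp [ratRed, hn]
  · simp [hn]

lemma map_eq_C_mul_polyRed {p : ℕ} [Fact p.Prime] {f : ℚ[X]} (hf : ∀ n, ¬ p ∣ (f.coeff n).den)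
    {b : ℤ} {f₀ : ℤ[X]} (h : f₀.map (Int.castRingHom ℚ) = C (b : ℚ) * f) :
    f₀.map (Int.castRingHom (ZMod p)) = C (b : ZMod p) * polyRed p f := by
  ext n
  have h1 := congrArg (fun q => coeff q n) h
  simp only [coeff_map, coeff_C_mul, coeff_polyRed, eq_intCast] at h1 ⊢
  have hd0 : ((f.coeff n).den : ℚ) ≠ 0 := by exact_mod_cast (f.coeff n).den_ne_zero
  have h2 : f₀.coeff n * ((f.coeff n).den : ℤ) = b * (f.coeff n).num := by
    have : ((f₀.coeff n : ℤ) : ℚ) * (f.coeff n).den = b * (f.coeff n).num := by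
      rw [h1, mul_assoc, Rat.mul_den_eq_num]
    exact_mod_cast this
  have h3 : ((f.coeff n).den : ZMod p) ≠ 0 := by
    rw [Ne, ZMod.natCast_eq_zero_iff]; exact hf n
  have h4 := congrArg (Int.cast : ℤ → ZMod p) h2
  push_cast at h4
  rw [ratRed, ← mul_assoc, ← h4, mul_assoc, mul_inv_cancel₀ h3, mul_one]

/-- For all but finitely many admissible primes, reduction preserves degrees and coprimality of
the numerator and the denominator. -/
lemma exists_good_reduction (P : RatFunc ℚ) (hP : ∀ c : ℚ, P ≠ RatFunc.C c) :
    ∃ m N : ℕ, 1 ≤ m ∧ ∀ (p : ℕ) [Fact p.Prime], N < p → Admissible p P →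
      m < p ∧ polyRed p P.denom ≠ 0 ∧ IsCoprime (polyRed p P.num) (polyRed p P.denom) ∧
        max (polyRed p P.num).natDegree (polyRed p P.denom).natDegree = m := by
  set f := P.num with hf
  set g := P.denom with hg
  have hg0 : g ≠ 0 := P.denom_ne_zero
  have hf0 : f ≠ 0 := by
    intro h0
    rw [hf, RatFunc.num_eq_zero_iff] at h0
    exact hP 0 (by rw [h0, map_zero])
  obtain ⟨u, v, huv⟩ : IsCoprime f g := P.isCoprime_num_denom
  obtain ⟨b, f₀, hb, hf₀⟩ := exists_integer_multiple f
  obtain ⟨c, g₀, hc, hg₀⟩ := exists_integer_multiple g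
  obtain ⟨d, u₀, hd, hu₀⟩ := exists_integer_multiple u
  obtain ⟨e, v₀, he, hv₀⟩ := exists_integer_multiple v
  have hinj : Function.Injective (Int.castRingHom ℚ) := Int.cast_injective
  have hbez : C (e * c) * u₀ * f₀ + C (d * b) * v₀ * g₀ = C (b * c * d * e) := by
    apply Polynomial.map_injective _ hinj
    simp only [Polynomial.map_add, Polynomial.map_mul, map_C, hf₀, hg₀, hu₀, hv₀,
      Int.coe_castRingHom, C_mul]
    linear_combination (C (b : ℚ) * C (c : ℚ) * C (d : ℚ) * C (e : ℚ)) * huv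
  have hdeg : ∀ {h : ℚ[X]} {a : ℤ} {h₀ : ℤ[X]}, a ≠ 0 →
      h₀.map (Int.castRingHom ℚ) = C (a : ℚ) * h → h₀.natDegree = h.natDegree := by
    intro h a h₀ ha hh
    rw [← natDegree_map_eq_of_injective hinj, hh, natDegree_C_mul (by exact_mod_cast ha)]
  have hne : ∀ {h : ℚ[X]} {a : ℤ} {h₀ : ℤ[X]}, a ≠ 0 → h ≠ 0 →
      h₀.map (Int.castRingHom ℚ) = C (a : ℚ) * h → h₀ ≠ 0 := by
    rintro h a h₀ ha h0 hh rfl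
    rw [Polynomial.map_zero] at hh
    exact mul_ne_zero (C_ne_zero.2 (by exact_mod_cast ha)) h0 hh.symm
  set Z : ℤ := b * c * d * e * f₀.leadingCoeff * g₀.leadingCoeff with hZ
  have hZ0 : Z ≠ 0 := by
    have h1 := leadingCoeff_ne_zero.2 (hne hb hf0 hf₀)
    have h2 := leadingCoeff_ne_zero.2 (hne hc hg0 hg₀)
    simp only [hZ]
    positivity
  refine ⟨max f.natDegree g.natDegree, max Z.natAbs (max f.natDegree g.natDegree), ?_, ?_⟩
  · by_contra! hcon
    have h1 : f.natDegree = 0 := by omega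
    have h2 : g.natDegree = 0 := by omega
    refine hP (f.coeff 0 / g.coeff 0) ?_
    rw [map_div₀, ← RatFunc.algebraMap_C, ← RatFunc.algebraMap_C, ← eq_C_of_natDegree_eq_zero h1,
      ← eq_C_of_natDegree_eq_zero h2, hf, hg, RatFunc.num_div_denom]
  · intro p _ hp hadm
    have hZp : (Z : ZMod p) ≠ 0 := by
      rw [Ne, ZMod.intCast_zmod_eq_zero_iff_dvd, Int.natCast_dvd]
      intro hdvd
      have := Nat.le_of_dvd (Int.natAbs_pos.2 hZ0) hdvd
      have := (le_max_left Z.natAbs (max f.natDegree g.natDegree)).trans_lt hp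
      omega
    simp only [hZ, Int.cast_mul, mul_ne_zero_iff] at hZp
    obtain ⟨⟨⟨⟨⟨hbp, hcp⟩, hdp⟩, hep⟩, hfp⟩, hgp⟩ := hZp
    have hfr := map_eq_C_mul_polyRed hadm.1 hf₀
    have hgr := map_eq_C_mul_polyRed hadm.2 hg₀
    rw [← hf] at hfr
    rw [← hg] at hgr
    have hfd : (polyRed p f).natDegree = f.natDegree := by
      rw [← hdeg hb hf₀, ← natDegree_map_of_leadingCoeff_ne_zero (Int.castRingHom (ZMod p)) hfp,
        hfr, natDegree_C_mul hbp]
    have hgd : (polyRed p g).natDegree = g.natDegree := by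
      rw [← hdeg hc hg₀, ← natDegree_map_of_leadingCoeff_ne_zero (Int.castRingHom (ZMod p)) hgp,
        hgr, natDegree_C_mul hcp]
    refine ⟨(le_max_right _ _).trans_lt hp, ?_, ?_, by rw [hfd, hgd]⟩
    · intro h0
      rw [h0, mul_zero] at hgr
      have := congrArg (fun q => coeff q g₀.natDegree) hgr
      rw [coeff_map, coeff_zero] at this
      exact hgp this
    · have h1 := congrArg (Polynomial.map (Int.castRingHom (ZMod p))) hbez
      simp only [Polynomial.map_add, Polynomial.map_mul, map_C, Int.coe_castRingHom, hfr, hgr,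
        Int.cast_mul] at h1
      have hk : (b : ZMod p) * c * d * e ≠ 0 := by simp [hbp, hcp, hdp, hep]
      refine ⟨C ((b : ZMod p) * c * d * e)⁻¹ * (C ((e : ZMod p) * c) *
        u₀.map (Int.castRingHom (ZMod p)) * C (b : ZMod p)),
        C ((b : ZMod p) * c * d * e)⁻¹ * (C ((d : ZMod p) * b) *
        v₀.map (Int.castRingHom (ZMod p)) * C (c : ZMod p)), ?_⟩
      have h2 : C ((b : ZMod p) * c * d * e)⁻¹ * C ((b : ZMod p) * c * d * e) = 1 := by
        rw [← C_mul, inv_mul_cancel₀ hk, C_1]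
      linear_combination C ((b : ZMod p) * c * d * e)⁻¹ * h1 + h2

end Reduction

section TwoTerm

/-- A Fourier bound for the number of representations of each value controls the error term of
the two-term average. -/
lemma norm_twoAvg1_sub_le (p : ℕ) [Fact p.Prime] (P : RatFunc ℚ) (f0 f1 : ZMod p × ZMod p → ℂ)
    (h0 : OneBounded f0) (h1 : OneBounded f1) (M : ℝ)
    (hM : ∀ ξ : ZMod p, ‖(∑ y, if ¬ IsPole p P y then ZMod.stdAddChar (ξ * evalRed p P y) else 0) -
      ∑ b, ZMod.stdAddChar (ξ * b)‖ ≤ M) :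
    ‖twoAvg1 p P f0 f1 - (p : ℂ)⁻¹ ^ 2 * ∑ x1 : ZMod p, ∑ x2 : ZMod p,
      f0 (x1, x2) * ((p : ℂ)⁻¹ * ∑ a : ZMod p, f1 (a, x2))‖ ≤ M * (p : ℝ)⁻¹ := by
  classical
  have hp : (0 : ℝ) < p := by exact_mod_cast (Fact.out : p.Prime).pos
  let κ : ZMod p → ℂ := fun b => (∑ y, if ¬ IsPole p P y ∧ evalRed p P y = b then 1 else 0) - 1
  have hκ : ∀ u : ZMod p → ℂ, ∑ b, κ b * u b =
      (∑ y, if ¬ IsPole p P y then u (evalRed p P y) else 0) - ∑ b, u b := by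
    intro u
    simp only [κ, sub_mul, one_mul, Finset.sum_sub_distrib, Finset.sum_mul]
    rw [Finset.sum_comm]
    congr 1
    refine Finset.sum_congr rfl fun y _ => ?_
    by_cases hy : IsPole p P y <;> simp [hy]
  have key : twoAvg1 p P f0 f1 - (p : ℂ)⁻¹ ^ 2 * ∑ x1 : ZMod p, ∑ x2 : ZMod p,
      f0 (x1, x2) * ((p : ℂ)⁻¹ * ∑ a : ZMod p, f1 (a, x2)) =
      (p : ℂ)⁻¹ ^ 3 * ∑ x2 : ZMod p, ∑ x1 : ZMod p, ∑ b, κ b * (f0 (x1, x2) * f1 (x1 + b, x2)) := by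
    have e : ∀ x1 x2 : ZMod p, ∑ b, κ b * (f0 (x1, x2) * f1 (x1 + b, x2)) =
        (∑ y, if ¬ IsPole p P y then f0 (x1, x2) * f1 (x1 + evalRed p P y, x2) else 0) -
          f0 (x1, x2) * ∑ a, f1 (a, x2) := by
      intro x1 x2
      have hshift := Equiv.sum_comp (Equiv.addLeft x1) fun a => f1 (a, x2)
      simp only [Equiv.coe_addLeft] at hshift
      rw [hκ fun b => f0 (x1, x2) * f1 (x1 + b, x2), ← Finset.mul_sum, hshift]
    conv_rhs => rw [Finset.sum_comm]
    simp only [e, Finset.sum_sub_distrib, mul_sub]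
    rw [twoAvg1]
    simp only [Finset.mul_sum]
    refine congrArg _ (Finset.sum_congr rfl fun x1 _ => Finset.sum_congr rfl fun x2 _ =>
      Finset.sum_congr rfl fun a _ => ?_)
    ring
  rw [key, norm_mul, norm_pow, norm_inv, Complex.norm_natCast]
  have hx2 : ∀ x2 : ZMod p,
      ‖∑ x1 : ZMod p, ∑ b, κ b * (f0 (x1, x2) * f1 (x1 + b, x2))‖ ≤ M * p := fun x2 =>
    norm_sum_kernel_le p κ (fun x => f0 (x, x2)) (fun x => f1 (x, x2)) M
      (fun ξ => by rw [hκ fun b => ZMod.stdAddChar (ξ * b)]; exact hM ξ)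
      (fun x => h0 _) (fun x => h1 _)
  have hsum := norm_sum_le_of_le Finset.univ fun x2 _ => hx2 x2
  rw [Finset.sum_const, Finset.card_univ, ZMod.card, nsmul_eq_mul] at hsum
  calc _ ≤ ((p : ℝ)⁻¹) ^ 3 * (p * (M * p)) := by gcongr
    _ = M * (p : ℝ)⁻¹ := by field_simp

lemma norm_sum_stdAddChar_evalRed_le (p : ℕ) [Fact p.Prime] (P : RatFunc ℚ) {m : ℕ} (hm : 1 ≤ m)
    (hmp : m < p) (hd : polyRed p P.denom ≠ 0)
    (hco : IsCoprime (polyRed p P.num) (polyRed p P.denom))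
    (hmax : max (polyRed p P.num).natDegree (polyRed p P.denom).natDegree = m) (ξ : ZMod p) :
    ‖(∑ y, if ¬ IsPole p P y then ZMod.stdAddChar (ξ * evalRed p P y) else 0) -
      ∑ b, ZMod.stdAddChar (ξ * b)‖ ≤ (2 + 2 * m) * √p := by
  classical
  have hp1 : (1 : ℝ) ≤ p := by exact_mod_cast (Fact.out : p.Prime).one_le
  have hsp : 1 ≤ √(p : ℝ) := Real.one_le_sqrt.2 hp1
  by_cases hξ : ξ = 0
  · subst hξ
    have e : (∑ y, if ¬ IsPole p P y then ZMod.stdAddChar (0 * evalRed p P y) else 0) -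
        ∑ b : ZMod p, ZMod.stdAddChar (0 * b) =
        - ((Finset.univ.filter fun y => IsPole p P y).card : ℂ) := by
      rw [← Finset.sum_sub_distrib, Finset.card_filter]
      push_cast
      rw [← Finset.sum_neg_distrib]
      refine Finset.sum_congr rfl fun y _ => ?_
      by_cases hy : IsPole p P y <;> simp [hy]
    rw [e, norm_neg, Complex.norm_natCast]
    have h1 : (Finset.univ.filter fun y => IsPole p P y).card ≤ m := by
      calc _ ≤ (polyRed p P.denom).roots.toFinset.card := by
            refine Finset.card_le_card fun y hy => ?_
            rw [Multiset.mem_toFinset, mem_roots hd]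
            exact (Finset.mem_filter.1 hy).2
        _ ≤ _ := (Multiset.toFinset_card_le _).trans (card_roots' _)
        _ ≤ m := hmax ▸ le_max_right _ _
    have h2 : ((Finset.univ.filter fun y => IsPole p P y).card : ℝ) ≤ m := by exact_mod_cast h1
    nlinarith [(Nat.cast_nonneg m : (0 : ℝ) ≤ m)]
  · have hψ : AddChar.mulShift (ZMod.stdAddChar (N := p)) ξ ≠ 0 :=
      ZMod.isPrimitive_stdAddChar p hξ
    have h1 := norm_sum_addChar_ratio_le _ hψ hco hd hmax hm hmp
    have h2 : ∑ b, ZMod.stdAddChar (ξ * b) = (0 : ℂ) :=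
      AddChar.sum_eq_zero_iff_ne_zero.2 hψ
    rw [h2, sub_zero]
    refine le_trans (le_of_eq ?_) (h1.trans (by nlinarith))
    congr 1

end TwoTerm

/-- **Proposition 5.3.(1).** Asymptotic formula for two-term progressions in the first
coordinate. -/
theorem two_term_first (P : RatFunc ℚ) (hP : ∀ c : ℚ, P ≠ RatFunc.C c) :
    ∃ C : ℝ, 0 < C ∧ ∀ (p : ℕ) [Fact p.Prime], Admissible p P →
      ∀ f0 f1 : ZMod p × ZMod p → ℂ, OneBounded f0 → OneBounded f1 →
        ‖twoAvg1 p P f0 f1 -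
            (p : ℂ)⁻¹ ^ 2 * ∑ x1 : ZMod p, ∑ x2 : ZMod p,
              f0 (x1, x2) * ((p : ℂ)⁻¹ * ∑ a : ZMod p, f1 (a, x2))‖ ≤
          C * (p : ℝ) ^ (-(1 : ℝ) / 2) := by
  obtain ⟨m, N, hm, hgood⟩ := exists_good_reduction P hP
  refine ⟨2 + 2 * m + 2 * √N, by positivity, fun p _ hadm f0 f1 h0 h1 => ?_⟩
  have hp : (0 : ℝ) < p := by exact_mod_cast (Fact.out : p.Prime).pos
  have hpow : (p : ℝ) ^ (-(1 : ℝ) / 2) = (√p)⁻¹ := by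
    rw [neg_div, Real.rpow_neg hp.le, Real.sqrt_eq_rpow]
  have hsq : (p : ℝ)⁻¹ = (√p)⁻¹ * (√p)⁻¹ := by
    rw [← mul_inv, Real.mul_self_sqrt hp.le]
  have hs0 : 0 < √(p : ℝ) := Real.sqrt_pos.2 hp
  rw [hpow]
  rcases lt_or_ge N p with hNp | hpN
  · obtain ⟨hmp, hd, hco, hmax⟩ := hgood p hNp hadm
    refine (norm_twoAvg1_sub_le p P f0 f1 h0 h1 _
      (norm_sum_stdAddChar_evalRed_le p P hm hmp hd hco hmax)).trans ?_
    calc (2 + 2 * (m : ℝ)) * √p * (p : ℝ)⁻¹ = (2 + 2 * m) * (√p)⁻¹ := by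
          rw [hsq]; field_simp
      _ ≤ _ := mul_le_mul_of_nonneg_right (by linarith [Real.sqrt_nonneg (N : ℝ)])
          (inv_nonneg.2 hs0.le)
  · refine (norm_twoAvg1_sub_le p P f0 f1 h0 h1 (2 * p) fun ξ => ?_).trans ?_
    · have hcard : ∀ u : ZMod p → ℂ, (∀ y, ‖u y‖ ≤ 1) → ‖∑ y, u y‖ ≤ p := fun u hu => by
        simpa using norm_sum_le_of_le Finset.univ fun y _ => hu y
      refine (norm_sub_le _ _).trans ((add_le_add (hcard _ fun y => ?_) (hcard _ fun y => ?_)).trans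
        (two_mul (p : ℝ)).ge)
      · split_ifs
        · simp
        · exact (AddChar.norm_apply (ZMod.stdAddChar (N := p)) _).le
      · exact (AddChar.norm_apply (ZMod.stdAddChar (N := p)) _).le
    · rw [mul_assoc, mul_inv_cancel₀ hp.ne', mul_one]
      have hle : √(p : ℝ) ≤ √N := Real.sqrt_le_sqrt (by exact_mod_cast hpN)
      rw [← div_eq_mul_inv, le_div_iff₀ hs0]
      linarith [(Nat.cast_nonneg m : (0 : ℝ) ≤ m)]

end RatCorners
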